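/- arXiv:1510.02305 — 9 statements merged into one kernel-verified Lean document; each statement's English description precedes it below -/
import Mathlib

section
/- Let n be a positive integer, let k ≥ 1, and let A_1, A_2, …, A_k be nonempty finite subsets of the additive group ℤ_n of integers modulo n. Let H = {h ∈ ℤ_n : h + (A_1 + A_2 + ⋯ + A_k) = A_1 + A_2 + ⋯ + A_k} be the stabilizer of the sumset A_1 + A_2 + ⋯ + A_k in ℤ_n. Then |A_1 + A_2 + ⋯ + A_k| ≥ |H| · (⌈|A_1|/|H|⌉ + ⌈|A_2|/|H|⌉ + ⋯ + ⌈|A_k|/|H|⌉ − (k − 1)). -/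
open Pointwise

section KneserAux

variable {G : Type*} [AddCommGroup G] [Fintype G] [DecidableEq G]

/-- stabilizer of a finset -/
def hs (S : Finset G) : Finset G := Finset.univ.filter (fun h => ∀ x, h + x ∈ S ↔ x ∈ S)

lemma mem_hs {S : Finset G} {h : G} : h ∈ hs S ↔ ∀ x, h + x ∈ S ↔ x ∈ S := by
  simp [hs]

lemma hs_zero (S : Finset G) : (0 : G) ∈ hs S := by simp [mem_hs]

lemma hs_add {S : Finset G} {a b : G} (ha : a ∈ hs S) (hb : b ∈ hs S) : a + b ∈ hs S := by
  rw [mem_hs] at *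
  intro x
  rw [add_assoc, ha, hb]

lemma hs_neg {S : Finset G} {a : G} (ha : a ∈ hs S) : -a ∈ hs S := by
  rw [mem_hs] at *
  intro x
  rw [← ha (-a + x)]; simp

lemma hs_pos (S : Finset G) : 0 < (hs S).card := Finset.card_pos.2 ⟨0, hs_zero S⟩

lemma mem_hs_of_forall {S : Finset G} {h : G} (H : ∀ x ∈ S, h + x ∈ S) : h ∈ hs S := by
  have h1 : S.image (fun x => h + x) = S := by
    apply Finset.eq_of_subset_of_card_le
    · intro y hy
      obtain ⟨x, hx, rfl⟩ := Finset.mem_image.1 hy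
      exact H x hx
    · rw [Finset.card_image_of_injective _ (add_right_injective h)]
  rw [mem_hs]
  intro x
  refine ⟨fun hx => ?_, H x⟩
  rw [← h1] at hx
  obtain ⟨y, hy, e⟩ := Finset.mem_image.1 hx
  have : y = x := add_left_cancel e
  exact this ▸ hy

/-- a finset stable under a subgroup-like finset K has card divisible by that of K -/
lemma card_dvd_of_stable (K S : Finset G) (h0 : (0 : G) ∈ K)
    (hadd : ∀ a ∈ K, ∀ b ∈ K, a + b ∈ K) (hneg : ∀ a ∈ K, -a ∈ K)
    (hS : ∀ a ∈ K, ∀ x ∈ S, a + x ∈ S) : K.card ∣ S.card := by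
  classical
  let f : G → Finset G := fun x => K.image (fun a => a + x)
  rw [Finset.card_eq_sum_card_image f S]
  apply Finset.dvd_sum
  intro b hb
  obtain ⟨x, hx, rfl⟩ := Finset.mem_image.1 hb
  have : S.filter (fun y => f y = f x) = f x := by
    ext y
    simp only [Finset.mem_filter]
    constructor
    · rintro ⟨hy, e⟩
      rw [← e]
      exact Finset.mem_image.2 ⟨0, h0, by simp⟩
    · intro hy
      obtain ⟨a, ha, rfl⟩ := Finset.mem_image.1 hy
      refine ⟨hS a ha x hx, ?_⟩
      ext z
      simp only [f, Finset.mem_image]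
      constructor
      · rintro ⟨c, hc, rfl⟩
        exact ⟨c + a, hadd c hc a ha, by abel⟩
      · rintro ⟨c, hc, rfl⟩
        exact ⟨c + -a, hadd c hc _ (hneg a ha), by abel⟩
  rw [this, Finset.card_image_of_injective _ (add_left_injective x)]

lemma grid_count (H1 H2 P U T : Finset G) (c : G) (hP : P ⊆ H1) (hU : U ⊆ H2)
    (hs1 : ∀ a ∈ H1, ∀ b ∈ H1, a - b ∈ H1) (hs2 : ∀ a ∈ H2, ∀ b ∈ H2, a - b ∈ H2)
    (hT : ∀ x ∈ P, ∀ y ∈ U, c + x + y ∈ T) :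
    P.card * U.card ≤ (H1 ∩ H2).card * T.card := by
  rw [← Finset.card_product]
  apply Finset.card_le_mul_card_image_of_maps_to (f := fun p : G × G => c + p.1 + p.2)
  · rintro ⟨x, y⟩ h
    have h := Finset.mem_product.1 h
    exact hT x h.1 y h.2
  · intro t ht
    rcases Finset.eq_empty_or_nonempty
      ((P ×ˢ U).filter (fun p : G × G => c + p.1 + p.2 = t)) with h | ⟨⟨x0, y0⟩, h⟩
    · simp [h]
    · simp only [Finset.mem_filter, Finset.mem_product] at h
      obtain ⟨⟨hx0, hy0⟩, e0⟩ := h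
      apply Finset.card_le_card_of_injOn (fun p : G × G => p.1 - x0)
      · rintro ⟨x, y⟩ h
        simp only [Finset.coe_filter, Finset.mem_product, Set.mem_setOf_eq] at h
        obtain ⟨⟨hx, hy⟩, e⟩ := h
        have e2 : x - x0 = y0 - y := by
          have : c + x + y = c + x0 + y0 := e.trans e0.symm
          have h3 : x + y = x0 + y0 := by
            rw [add_assoc, add_assoc] at this
            exact add_left_cancel this
          rw [sub_eq_sub_iff_add_eq_add, h3, add_comm]
        simp only [Finset.coe_inter, Set.mem_inter_iff, Finset.mem_coe]
        exact ⟨hs1 _ (hP hx) _ (hP hx0), e2 ▸ hs2 _ (hU hy0) _ (hU hy)⟩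
      · rintro ⟨x, y⟩ h ⟨x', y'⟩ h' e
        simp only [Finset.coe_filter, Finset.mem_product, Set.mem_setOf_eq] at h h' e
        have hx : x = x' := sub_left_injective e
        subst hx
        have := h.2.trans h'.2.symm
        have hy : y = y' := add_left_cancel this
        rw [hy]

lemma hs_sub {S : Finset G} {a b : G} (ha : a ∈ hs S) (hb : b ∈ hs S) : a - b ∈ hs S := by
  rw [sub_eq_add_neg]; exact hs_add ha (hs_neg hb)

/-- grid numbers at a point of C2 \ C1 -/
lemma grid_nums (C1 C2 : Finset G) (c : G) (h1 : c ∉ C1) (h2 : c ∈ C2) :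
    ∃ p v u q : ℕ, 1 ≤ p ∧ 1 ≤ u ∧
      (hs C1).card = (hs C1 ∩ hs C2).card * (p + v) ∧
      (hs C2).card = (hs C1 ∩ hs C2).card * (u + q) ∧
      (hs C1 ∩ hs C2).card * (p * u) ≤ (C2 \ C1).card ∧
      (hs C1 ∩ hs C2).card * (v * q) ≤ (C1 \ C2).card := by
  set K := hs C1 ∩ hs C2 with hK
  have hK0 : (0 : G) ∈ K := Finset.mem_inter.2 ⟨hs_zero _, hs_zero _⟩
  have hKpos : 0 < K.card := Finset.card_pos.2 ⟨0, hK0⟩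
  have hKa : ∀ a ∈ K, ∀ b ∈ K, a + b ∈ K := by
    intro a ha b hb
    rw [hK, Finset.mem_inter] at *
    exact ⟨hs_add ha.1 hb.1, hs_add ha.2 hb.2⟩
  have hKn : ∀ a ∈ K, -a ∈ K := by
    intro a ha
    rw [hK, Finset.mem_inter] at *
    exact ⟨hs_neg ha.1, hs_neg ha.2⟩
  let P := (hs C1).filter (fun x => c + x ∈ C2)
  let V := (hs C1).filter (fun x => ¬ c + x ∈ C2)
  let U := (hs C2).filter (fun x => ¬ c + x ∈ C1)
  let Q := (hs C2).filter (fun x => c + x ∈ C1)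
  have e1 : P.card + V.card = (hs C1).card := Finset.card_filter_add_card_filter_not _
  have e2 : Q.card + U.card = (hs C2).card := Finset.card_filter_add_card_filter_not _
  have st1 : ∀ a ∈ K, ∀ x, c + (a + x) ∈ C1 ↔ c + x ∈ C1 := by
    intro a ha x
    rw [show c + (a + x) = a + (c + x) by abel]
    exact mem_hs.1 (Finset.mem_inter.1 ha).1 _
  have st2 : ∀ a ∈ K, ∀ x, c + (a + x) ∈ C2 ↔ c + x ∈ C2 := by
    intro a ha x
    rw [show c + (a + x) = a + (c + x) by abel]
    exact mem_hs.1 (Finset.mem_inter.1 ha).2 _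
  have dP : K.card ∣ P.card := by
    apply card_dvd_of_stable K P hK0 hKa hKn
    intro a ha x hx
    simp only [P, Finset.mem_filter] at hx ⊢
    exact ⟨hs_add (Finset.mem_inter.1 ha).1 hx.1, (st2 a ha x).2 hx.2⟩
  have dV : K.card ∣ V.card := by
    apply card_dvd_of_stable K V hK0 hKa hKn
    intro a ha x hx
    simp only [V, Finset.mem_filter] at hx ⊢
    exact ⟨hs_add (Finset.mem_inter.1 ha).1 hx.1, fun h => hx.2 ((st2 a ha x).1 h)⟩
  have dQ : K.card ∣ Q.card := by
    apply card_dvd_of_stable K Q hK0 hKa hKn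
    intro a ha x hx
    simp only [Q, Finset.mem_filter] at hx ⊢
    exact ⟨hs_add (Finset.mem_inter.1 ha).2 hx.1, (st1 a ha x).2 hx.2⟩
  have dU : K.card ∣ U.card := by
    apply card_dvd_of_stable K U hK0 hKa hKn
    intro a ha x hx
    simp only [U, Finset.mem_filter] at hx ⊢
    exact ⟨hs_add (Finset.mem_inter.1 ha).2 hx.1, fun h => hx.2 ((st1 a ha x).1 h)⟩
  have t1 : ∀ x ∈ hs C1, ∀ y, c + x + y ∈ C1 ↔ c + y ∈ C1 := by
    intro x hx y
    rw [show c + x + y = x + (c + y) by abel]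
    exact mem_hs.1 hx _
  have t2 : ∀ x, ∀ y ∈ hs C2, c + x + y ∈ C2 ↔ c + x ∈ C2 := by
    intro x y hy
    rw [show c + x + y = y + (c + x) by abel]
    exact mem_hs.1 hy _
  have g1 : P.card * U.card ≤ K.card * (C2 \ C1).card := by
    apply grid_count (hs C1) (hs C2) P U _ c (Finset.filter_subset _ _) (Finset.filter_subset _ _)
      (fun a ha b hb => hs_sub ha hb) (fun a ha b hb => hs_sub ha hb)
    intro x hx y hy
    simp only [P, U, Finset.mem_filter] at hx hy
    rw [Finset.mem_sdiff, t1 x hx.1, t2 x y hy.1]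
    exact ⟨hx.2, hy.2⟩
  have g2 : V.card * Q.card ≤ K.card * (C1 \ C2).card := by
    apply grid_count (hs C1) (hs C2) V Q _ c (Finset.filter_subset _ _) (Finset.filter_subset _ _)
      (fun a ha b hb => hs_sub ha hb) (fun a ha b hb => hs_sub ha hb)
    intro x hx y hy
    simp only [V, Q, Finset.mem_filter] at hx hy
    rw [Finset.mem_sdiff, t1 x hx.1, t2 x y hy.1]
    exact ⟨hy.2, hx.2⟩
  have hPp : 0 < P.card := Finset.card_pos.2 ⟨0, by simp [P, hs_zero, h2]⟩
  have hUp : 0 < U.card := Finset.card_pos.2 ⟨0, by simp [U, hs_zero, h1]⟩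
  obtain ⟨p, ep⟩ := dP
  obtain ⟨v, ev⟩ := dV
  obtain ⟨u, eu⟩ := dU
  obtain ⟨q, eq⟩ := dQ
  refine ⟨p, v, u, q, ?_, ?_, ?_, ?_, ?_, ?_⟩
  · rcases Nat.eq_zero_or_pos p with h | h
    · rw [h] at ep; omega
    · exact h
  · rcases Nat.eq_zero_or_pos u with h | h
    · rw [h] at eu; omega
    · exact h
  · rw [← e1, ep, ev]; ring
  · rw [← e2, eu, eq]; ring
  · apply Nat.le_of_mul_le_mul_left _ hKpos
    calc K.card * (K.card * (p * u)) = P.card * U.card := by rw [ep, eu]; ring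
      _ ≤ _ := g1
  · apply Nat.le_of_mul_le_mul_left _ hKpos
    calc K.card * (K.card * (v * q)) = V.card * Q.card := by rw [ev, eq]; ring
      _ ≤ _ := g2

/-- arithmetic: either done or `q = 0` and `|C2 \ C1| ≥ |H2|` -/
lemma grid_arith (k p v u q X Y h1 h2 : ℕ) (hp : 1 ≤ p) (hu : 1 ≤ u)
    (e1 : h1 = k * (p + v)) (e2 : h2 = k * (u + q))
    (b1 : k * (p * u) ≤ X) (b2 : k * (v * q) ≤ Y) :
    h1 ≤ X + k ∨ h2 ≤ Y + k ∨ h2 ≤ X := by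
  rcases Nat.eq_zero_or_pos q with hq | hq
  · right; right
    subst hq
    rw [e2]
    refine le_trans ?_ b1
    apply Nat.mul_le_mul_left
    nlinarith
  · rcases le_total v u with h | h
    · left
      rw [e1]
      have : p + v ≤ p * u + 1 := by nlinarith
      calc k * (p + v) ≤ k * (p * u + 1) := Nat.mul_le_mul_left _ this
        _ = k * (p * u) + k := by ring
        _ ≤ _ := by omega
    · right; left
      rw [e2]
      have : u + q ≤ v * q + 1 := by nlinarith
      calc k * (u + q) ≤ k * (v * q + 1) := Nat.mul_le_mul_left _ this
        _ = k * (v * q) + k := by ring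
        _ ≤ _ := by omega

lemma union_bound (C1 C2 : Finset G) (m : ℕ) (h1 : m ≤ C1.card + (hs C1).card)
    (h2 : m ≤ C2.card + (hs C2).card) : m ≤ (C1 ∪ C2).card + (hs (C1 ∪ C2)).card := by
  by_cases s1 : C2 ⊆ C1
  · rwa [Finset.union_eq_left.2 s1]
  by_cases s2 : C1 ⊆ C2
  · rwa [Finset.union_eq_right.2 s2]
  obtain ⟨c, hc2, hc1⟩ := Finset.not_subset.1 s1
  obtain ⟨d, hd1, hd2⟩ := Finset.not_subset.1 s2
  obtain ⟨p, v, u, q, hp, hu, e1, e2, b1, b2⟩ := grid_nums C1 C2 c hc1 hc2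
  obtain ⟨p', v', u', q', hp', hu', e1', e2', b1', b2'⟩ := grid_nums C2 C1 d hd2 hd1
  have A := grid_arith _ _ _ _ _ _ _ _ _ hp hu e1 e2 b1 b2
  have B := grid_arith _ _ _ _ _ _ _ _ _ hp' hu' e1' e2' b1' b2'
  rw [Finset.inter_comm (hs C2)] at B
  have hk : (hs C1 ∩ hs C2).card ≤ (hs (C1 ∪ C2)).card := by
    apply Finset.card_le_card
    intro a ha
    rw [Finset.mem_inter, mem_hs, mem_hs] at ha
    rw [mem_hs]
    intro x
    rw [Finset.mem_union, Finset.mem_union, ha.1, ha.2]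
  have c1 : (C2 \ C1).card + C1.card = (C1 ∪ C2).card := by
    rw [Finset.card_sdiff_add_card, Finset.union_comm]
  have c2 : (C1 \ C2).card + C2.card = (C1 ∪ C2).card := by
    rw [Finset.card_sdiff_add_card]
  omega

lemma exists_piece (N : ℕ) : ∀ A B : Finset G, B.card = N → (0 : G) ∈ A → (0 : G) ∈ B →
    ∃ C : Finset G, 0 ∈ C ∧ C ⊆ A + B ∧ A.card + B.card ≤ C.card + (hs C).card := by
  induction N using Nat.strong_induction_on with
  | _ N ih =>
  intro A B hN hA hB
  by_cases h : ∀ e ∈ A, ∀ b ∈ B, b + e ∈ A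
  · refine ⟨A, hA, fun x hx => ?_, ?_⟩
    · exact Finset.mem_add.2 ⟨x, hx, 0, hB, by simp⟩
    · apply Nat.add_le_add_left
      apply Finset.card_le_card
      intro b hb
      exact mem_hs_of_forall (fun x hx => h x hx b hb)
  · push Not at h
    obtain ⟨e, he, b, hb, hbe⟩ := h
    let B' := B.filter (fun y => y + e ∈ A)
    let A' := A ∪ B.image (fun y => y + e)
    have hlt : B'.card < N := by
      rw [← hN]
      apply Finset.card_lt_card
      rw [Finset.filter_ssubset]
      exact ⟨b, hb, hbe⟩
    obtain ⟨C, h0, hC, hle⟩ := ih _ hlt A' B' rfl (Finset.mem_union_left _ hA)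
      (by simp [B', hB, he])
    refine ⟨C, h0, hC.trans ?_, ?_⟩
    · intro x hx
      obtain ⟨y, hy, z, hz, rfl⟩ := Finset.mem_add.1 hx
      simp only [B', Finset.mem_filter] at hz
      rcases Finset.mem_union.1 hy with hy | hy
      · exact Finset.add_mem_add hy hz.1
      · obtain ⟨w, hw, rfl⟩ := Finset.mem_image.1 hy
        rw [show w + e + z = (z + e) + w by abel]
        exact Finset.add_mem_add hz.2 hw
    · refine le_trans ?_ hle
      have h1 := Finset.card_union_add_card_inter A (B.image (fun y => y + e))
      rw [Finset.card_image_of_injective _ (add_left_injective e)] at h1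
      have h2 : (A ∩ B.image (fun y => y + e)).card ≤ B'.card := by
        rw [← Finset.card_image_of_injective B' (add_left_injective e)]
        apply Finset.card_le_card
        intro x hx
        obtain ⟨hx, hx'⟩ := Finset.mem_inter.1 hx
        obtain ⟨w, hw, rfl⟩ := Finset.mem_image.1 hx'
        exact Finset.mem_image.2 ⟨w, by simp [B', hw]; exact hx, rfl⟩
      change A.card + B.card ≤ (A ∪ B.image (fun y => y + e)).card + B'.card
      omega

lemma exists_piece' (A B : Finset G) (a b : G) (ha : a ∈ A) (hb : b ∈ B) :
    ∃ C : Finset G, a + b ∈ C ∧ C ⊆ A + B ∧ A.card + B.card ≤ C.card + (hs C).card := by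
  obtain ⟨C, h0, hC, hle⟩ := exists_piece _ (A.image (fun x => x - a)) (B.image (fun x => x - b))
    rfl (Finset.mem_image.2 ⟨a, ha, by simp⟩) (Finset.mem_image.2 ⟨b, hb, by simp⟩)
  refine ⟨C.image (fun x => x + (a + b)), Finset.mem_image.2 ⟨0, h0, by simp⟩, ?_, ?_⟩
  · intro x hx
    obtain ⟨y, hy, rfl⟩ := Finset.mem_image.1 hx
    obtain ⟨z, hz, w, hw, rfl⟩ := Finset.mem_add.1 (hC hy)
    obtain ⟨z, hz1, rfl⟩ := Finset.mem_image.1 hz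
    obtain ⟨w, hw1, rfl⟩ := Finset.mem_image.1 hw
    rw [show z - a + (w - b) + (a + b) = z + w by abel]
    exact Finset.add_mem_add hz1 hw1
  · rw [Finset.card_image_of_injective _ (sub_left_injective),
      Finset.card_image_of_injective _ (sub_left_injective)] at hle
    rw [Finset.card_image_of_injective _ (add_left_injective (a + b))]
    refine hle.trans (Nat.add_le_add_left (Finset.card_le_card ?_) _)
    intro h hh
    apply mem_hs_of_forall
    intro x hx
    obtain ⟨y, hy, rfl⟩ := Finset.mem_image.1 hx
    exact Finset.mem_image.2 ⟨h + y, (mem_hs.1 hh y).2 hy, by abel⟩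

/-- Kneser's theorem, weak form -/
lemma kneser_weak (A B : Finset G) (hA : A.Nonempty) (hB : B.Nonempty) :
    A.card + B.card ≤ (A + B).card + (hs (A + B)).card := by
  have key : ∀ x ∈ A + B, ∃ C : Finset G, x ∈ C ∧ C ⊆ A + B ∧
      A.card + B.card ≤ C.card + (hs C).card := by
    intro x hx
    obtain ⟨a, ha, b, hb, rfl⟩ := Finset.mem_add.1 hx
    exact exists_piece' A B a b ha hb
  have main : ∀ S : Finset G, S.Nonempty → S ⊆ A + B → ∃ C : Finset G, S ⊆ C ∧ C ⊆ A + B ∧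
      A.card + B.card ≤ C.card + (hs C).card := by
    intro S hS
    induction hS using Finset.Nonempty.cons_induction with
    | singleton a =>
      intro h
      obtain ⟨C, h1, h2, h3⟩ := key a (h (Finset.mem_singleton_self a))
      exact ⟨C, Finset.singleton_subset_iff.2 h1, h2, h3⟩
    | cons a s ha hs' ih =>
      intro h
      obtain ⟨C, h1, h2, h3⟩ := key a (h (Finset.mem_cons_self a s))
      obtain ⟨D, d1, d2, d3⟩ := ih (fun x hx => h (Finset.mem_cons_of_mem hx))
      refine ⟨C ∪ D, ?_, Finset.union_subset h2 d2, union_bound C D _ h3 d3⟩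
      intro x hx
      rcases Finset.mem_cons.1 hx with rfl | hx
      · exact Finset.mem_union_left _ h1
      · exact Finset.mem_union_right _ (d1 hx)
  obtain ⟨C, h1, h2, h3⟩ := main (A + B) (hA.add hB) subset_rfl
  rwa [← Finset.Subset.antisymm h1 h2] at h3

lemma hs_subset_hs_add (A B : Finset G) : hs B ⊆ hs (A + B) := by
  intro h hh
  apply mem_hs_of_forall
  intro x hx
  obtain ⟨a, ha, b, hb, rfl⟩ := Finset.mem_add.1 hx
  rw [show h + (a + b) = a + (h + b) by abel]
  exact Finset.add_mem_add ha ((mem_hs.1 hh b).2 hb)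

lemma sum_nonempty_aux {ι : Type*} (B : ι → Finset G) (hB : ∀ i, (B i).Nonempty) (s : Finset ι) :
    (∑ i ∈ s, B i).Nonempty := by
  classical
  induction s using Finset.induction_on with
  | empty => simp
  | insert a s ha ih => rw [Finset.sum_insert ha]; exact (hB a).add ih

lemma kneser_multi {ι : Type*} (B : ι → Finset G) (hB : ∀ i, (B i).Nonempty) (H : Finset G)
    (hst : ∀ i, H ⊆ hs (B i)) (s : Finset ι) (hs0 : s.Nonempty) :
    hs (∑ i ∈ s, B i) ⊆ H →
    ∑ i ∈ s, (B i).card + H.card ≤ (∑ i ∈ s, B i).card + s.card * H.card := by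
  classical
  induction hs0 using Finset.Nonempty.cons_induction with
  | singleton a => intro _; simp
  | cons a s ha hs' ih =>
    intro h
    rw [Finset.sum_cons] at h
    have h1 := ih ((hs_subset_hs_add _ _).trans h)
    have h2 := kneser_weak (B a) (∑ i ∈ s, B i) (hB a) (sum_nonempty_aux B hB s)
    have h3 := Finset.card_le_card h
    rw [Finset.sum_cons, Finset.sum_cons, Finset.card_cons, add_mul]
    omega

end KneserAux

/-- Generalized Cauchy–Davenport theorem over ℤ_n, stabilizer form. -/
theorem generalized_cauchy_davenport_stabilizer
    (n k : ℕ) (hn : 0 < n) (hk : 1 ≤ k)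
    (A : Fin k → Finset (ZMod n)) (hA : ∀ i, (A i).Nonempty)
    (H : Finset (ZMod n))
    (hH : ∀ h : ZMod n,
      h ∈ H ↔ Finset.image (fun x => h + x) (∑ i, A i) = ∑ i, A i) :
    ((∑ i, A i).card : ℤ) ≥
      (H.card : ℤ) *
        (∑ i, ⌈((A i).card : ℚ) / (H.card : ℚ)⌉ - ((k : ℤ) - 1)) := by
  haveI : NeZero n := ⟨hn.ne'⟩
  have hHe : H = hs (∑ i, A i) := by
    ext h
    rw [hH]
    constructor
    · intro e
      apply mem_hs_of_forall
      intro x hx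
      rw [← e]
      exact Finset.mem_image_of_mem _ hx
    · intro hh
      apply Finset.eq_of_subset_of_card_le
      · intro y hy
        obtain ⟨x, hx, rfl⟩ := Finset.mem_image.1 hy
        exact (mem_hs.1 hh x).2 hx
      · rw [Finset.card_image_of_injective _ (add_right_injective h)]
  have H0 : (0 : ZMod n) ∈ H := hHe ▸ hs_zero _
  have Ha : ∀ a ∈ H, ∀ b ∈ H, a + b ∈ H := by
    intro a ha b hb; rw [hHe] at *; exact hs_add ha hb
  have Hn : ∀ a ∈ H, -a ∈ H := by
    intro a ha; rw [hHe] at *; exact hs_neg ha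
  have Hpos : 0 < H.card := Finset.card_pos.2 ⟨0, H0⟩
  have hst : ∀ i, H ⊆ hs (A i + H) := by
    intro i h hh
    apply mem_hs_of_forall
    intro x hx
    obtain ⟨a, ha, b, hb, rfl⟩ := Finset.mem_add.1 hx
    rw [show h + (a + b) = a + (h + b) by abel]
    exact Finset.add_mem_add ha (Ha h hh b hb)
  have hSH : (∑ i, A i) + H = ∑ i, A i := by
    apply Finset.Subset.antisymm
    · intro x hx
      obtain ⟨a, ha, b, hb, rfl⟩ := Finset.mem_add.1 hx
      rw [hHe] at hb
      rw [add_comm]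
      exact (mem_hs.1 hb a).2 ha
    · intro x hx
      exact Finset.mem_add.2 ⟨x, hx, 0, H0, by simp⟩
  have hsum : ∑ i, (A i + H) = ∑ i, A i := by
    rw [Finset.sum_add_distrib, Finset.sum_const]
    generalize (Finset.univ : Finset (Fin k)).card = m
    induction m with
    | zero => simp
    | succ m ih => rw [succ_nsmul, ← add_assoc, ih, hSH]
  have main := kneser_multi (fun i => A i + H) (fun i => (hA i).add ⟨0, H0⟩) H hst Finset.univ
    ⟨⟨0, hk⟩, Finset.mem_univ _⟩ (by rw [hsum, ← hHe])
  rw [hsum, Finset.card_univ, Fintype.card_fin] at main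
  have hceil : ∀ i, (H.card : ℤ) * ⌈((A i).card : ℚ) / (H.card : ℚ)⌉ ≤ ((A i + H).card : ℤ) := by
    intro i
    obtain ⟨t, ht⟩ := card_dvd_of_stable H (A i + H) H0 Ha Hn
      (fun a ha x hx => (mem_hs.1 (hst i ha) x).2 hx)
    have hle : (A i).card ≤ (A i + H).card := by
      apply Finset.card_le_card
      intro x hx
      exact Finset.mem_add.2 ⟨x, hx, 0, H0, by simp⟩
    rw [ht] at hle ⊢
    push_cast
    apply mul_le_mul_of_nonneg_left _ (by positivity)
    rw [Int.ceil_le, div_le_iff₀ (by exact_mod_cast Hpos)]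
    push_cast
    rw [mul_comm]
    exact_mod_cast hle
  have hs1 : (H.card : ℤ) * ∑ i, ⌈((A i).card : ℚ) / (H.card : ℚ)⌉ ≤
      ∑ i, ((A i + H).card : ℤ) := by
    rw [Finset.mul_sum]
    exact Finset.sum_le_sum (fun i _ => hceil i)
  have main' : ∑ i, ((A i + H).card : ℤ) + H.card ≤ ((∑ i, A i).card : ℤ) + k * H.card := by
    exact_mod_cast main
  rw [ge_iff_le, mul_sub]
  linarith
end

section
/- Let n be a positive integer, let k ≥ 1, and let A_1, A_2, …, A_k be nonempty finite subsets of the additive group ℤ_n of integers modulo n. Then |A_1 + A_2 + ⋯ + A_k| ≥ min over all positive divisors d of n of d · (⌈|A_1|/d⌉ + ⌈|A_2|/d⌉ + ⋯ + ⌈|A_k|/d⌉ − (k − 1)). -/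
open Pointwise

section GCD
open Finset

variable {G : Type*} [AddCommGroup G] [Fintype G] [DecidableEq G]

open Classical in
/-- The finset of elements of a subgroup. -/
noncomputable def gcdFs (H : AddSubgroup G) : Finset G := Finset.univ.filter (· ∈ H)

omit [DecidableEq G] in
lemma mem_gcdFs (H : AddSubgroup G) (x : G) : x ∈ gcdFs H ↔ x ∈ H := by
  simp [gcdFs]

/-- `H` is a group of periods of `C`. -/
def gcdPer (C : Finset G) (H : AddSubgroup G) : Prop := ∀ h ∈ H, ∀ x ∈ C, x + h ∈ C

omit [Fintype G] [DecidableEq G] in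
lemma gcdPer.iff {C : Finset G} {H : AddSubgroup G} (hC : gcdPer C H) {h x : G} (hh : h ∈ H) :
    x + h ∈ C ↔ x ∈ C := by
  refine ⟨fun hx => ?_, hC h hh x⟩
  have := hC (-h) (H.neg_mem hh) _ hx
  simpa using this

lemma gcd_fiber (H₁ H₂ : AddSubgroup G) (c : G) (R S X : Finset G)
    (hR : ∀ r ∈ R, r ∈ H₂) (hS : ∀ s ∈ S, s ∈ H₁)
    (hX : ∀ r ∈ R, ∀ s ∈ S, c + r + s ∈ X) :
    R.card * S.card ≤ (gcdFs (H₁ ⊓ H₂)).card * X.card := by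
  rw [← card_product]
  refine Finset.card_le_mul_card_image_of_maps_to (f := fun p : G × G => c + p.1 + p.2) ?_ _ ?_
  · intro p hp
    rw [mem_product] at hp
    exact hX _ hp.1 _ hp.2
  · intro b _
    rcases Finset.eq_empty_or_nonempty {a ∈ R ×ˢ S | c + a.1 + a.2 = b} with h | ⟨p₀, hp₀⟩
    · rw [h]; simp
    · rw [mem_filter, mem_product] at hp₀
      refine Finset.card_le_card_of_injOn (fun p => p.1 - p₀.1) ?_ ?_
      · intro p hp
        rw [mem_coe, mem_filter, mem_product] at hp
        rw [mem_coe, mem_gcdFs]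
        have e : c + p.1 + p.2 = c + p₀.1 + p₀.2 := hp.2.trans hp₀.2.symm
        refine ⟨?_, H₂.sub_mem (hR _ hp.1.1) (hR _ hp₀.1.1)⟩
        have e2 : p.1 - p₀.1 = p₀.2 - p.2 := by
          rw [add_assoc, add_assoc] at e
          have := add_left_cancel e
          rw [sub_eq_sub_iff_add_eq_add, this, add_comm]
        show p.1 - p₀.1 ∈ H₁
        rw [e2]
        exact H₁.sub_mem (hS _ hp₀.1.2) (hS _ hp.1.2)
      · intro p hp q hq hpq
        rw [mem_coe, mem_filter, mem_product] at hp hq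
        have e1 : p.1 = q.1 := by simpa using hpq
        have e : c + p.1 + p.2 = c + q.1 + q.2 := hp.2.trans hq.2.symm
        rw [e1] at e
        exact Prod.ext e1 (add_left_cancel e)

omit [DecidableEq G] in
lemma gcd_sub_card (M : AddSubgroup G) (T : Finset G) (hT : gcdPer T M) (hne : T.Nonempty) :
    (gcdFs M).card ≤ T.card := by
  obtain ⟨t, ht⟩ := hne
  refine Finset.card_le_card_of_injOn (fun h => t + h) ?_ ?_
  · intro h hh
    exact hT h ((mem_gcdFs _ _).1 hh) t ht
  · intro a _ b _ hab
    exact add_left_cancel hab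

lemma gcd_arith (m r s r' s' h1 h2 x y : ℕ) (hr : r + r' = h2) (hs : s + s' = h1)
    (hle : h1 ≤ h2) (hm : 0 < m)
    (hrm : m ≤ r) (hsm : m ≤ s) (hr' : r' = 0 ∨ m ≤ r') (hs' : s' = 0 ∨ m ≤ s')
    (hx : r * s ≤ m * x) (hy : r' * s' ≤ m * y) : h1 ≤ x + m ∨ h2 ≤ y + m := by
  subst hr hs
  rcases hr' with rfl | hr'
  · left
    have : m * r ≤ m * x := by nlinarith
    have := Nat.le_of_mul_le_mul_left this hm
    omega
  rcases hs' with rfl | hs'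
  · left
    have : m * s ≤ m * x := by nlinarith
    have := Nat.le_of_mul_le_mul_left this hm
    omega
  by_contra! hcon
  obtain ⟨h1, h2⟩ := hcon
  obtain ⟨a, rfl⟩ := Nat.exists_eq_add_of_le hrm
  obtain ⟨b, rfl⟩ := Nat.exists_eq_add_of_le hsm
  obtain ⟨a', rfl⟩ := Nat.exists_eq_add_of_le hr'
  obtain ⟨b', rfl⟩ := Nat.exists_eq_add_of_le hs'
  have e1 : m * (m + a + b) ≤ m * x := by nlinarith [Nat.zero_le (a * b)]
  have e2 : m * (m + a' + b') ≤ m * y := by nlinarith [Nat.zero_le (a' * b')]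
  have e1 := Nat.le_of_mul_le_mul_left e1 hm
  have e2 := Nat.le_of_mul_le_mul_left e2 hm
  omega

lemma gcd_union_aux (C₁ C₂ : Finset G) (H₁ H₂ : AddSubgroup G) (h₁ : gcdPer C₁ H₁)
    (h₂ : gcdPer C₂ H₂) (hle : (gcdFs H₁).card ≤ (gcdFs H₂).card) (c : G) (hc2 : c ∈ C₂)
    (hc1 : c ∉ C₁) :
    (gcdFs H₁).card ≤ (C₂ \ C₁).card + (gcdFs (H₁ ⊓ H₂)).card ∨
    (gcdFs H₂).card ≤ (C₁ \ C₂).card + (gcdFs (H₁ ⊓ H₂)).card := by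
  have key1 : ∀ r ∈ H₂, ∀ s ∈ H₁, (c + r + s ∈ C₁ ↔ c + r ∈ C₁) := fun r _ s hs => h₁.iff hs
  have key2 : ∀ r ∈ H₂, ∀ s ∈ H₁, (c + r + s ∈ C₂ ↔ c + s ∈ C₂) := fun r hr s _ => by
    rw [add_right_comm]; exact h₂.iff hr
  have p1 : ∀ m ∈ H₁ ⊓ H₂, ∀ x, (c + (x + m) ∈ C₁ ↔ c + x ∈ C₁) := fun m hm x => by
    rw [← add_assoc]; exact h₁.iff hm.1
  have p2 : ∀ m ∈ H₁ ⊓ H₂, ∀ x, (c + (x + m) ∈ C₂ ↔ c + x ∈ C₂) := fun m hm x => by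
    rw [← add_assoc]; exact h₂.iff hm.2
  have m1 : ∀ m ∈ H₁ ⊓ H₂, ∀ x, x ∈ H₁ → x + m ∈ H₁ := fun m hm x hx => H₁.add_mem hx hm.1
  have m2 : ∀ m ∈ H₁ ⊓ H₂, ∀ x, x ∈ H₂ → x + m ∈ H₂ := fun m hm x hx => H₂.add_mem hx hm.2
  refine gcd_arith (gcdFs (H₁ ⊓ H₂)).card
    ((gcdFs H₂).filter (fun r => ¬ c + r ∈ C₁)).card ((gcdFs H₁).filter (fun s => c + s ∈ C₂)).card
    ((gcdFs H₂).filter (fun r => c + r ∈ C₁)).card ((gcdFs H₁).filter (fun s => ¬ c + s ∈ C₂)).card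
    _ _ _ _ ?_ ?_ hle ?_ ?_ ?_ ?_ ?_ ?_ ?_
  · rw [add_comm]; exact card_filter_add_card_filter_not _
  · exact card_filter_add_card_filter_not _
  · exact card_pos.2 ⟨0, (mem_gcdFs _ _).2 (zero_mem _)⟩
  · refine gcd_sub_card _ _ ?_ ⟨0, ?_⟩
    · intro m hm x hx
      simp only [mem_filter, mem_gcdFs] at hx ⊢
      exact ⟨m2 m hm x hx.1, by rw [p1 m hm]; exact hx.2⟩
    · simp [mem_gcdFs, hc1]
  · refine gcd_sub_card _ _ ?_ ⟨0, ?_⟩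
    · intro m hm x hx
      simp only [mem_filter, mem_gcdFs] at hx ⊢
      exact ⟨m1 m hm x hx.1, by rw [p2 m hm]; exact hx.2⟩
    · simp [mem_gcdFs, hc2]
  · rw [card_eq_zero]
    refine (Finset.eq_empty_or_nonempty _).imp_right fun h => gcd_sub_card _ _ ?_ h
    intro m hm x hx
    simp only [mem_filter, mem_gcdFs] at hx ⊢
    exact ⟨m2 m hm x hx.1, by rw [p1 m hm]; exact hx.2⟩
  · rw [card_eq_zero]
    refine (Finset.eq_empty_or_nonempty _).imp_right fun h => gcd_sub_card _ _ ?_ h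
    intro m hm x hx
    simp only [mem_filter, mem_gcdFs] at hx ⊢
    exact ⟨m1 m hm x hx.1, by rw [p2 m hm]; exact hx.2⟩
  · refine gcd_fiber H₁ H₂ c _ _ _ ?_ ?_ ?_
    · intro r hr; simp only [mem_filter, mem_gcdFs] at hr; exact hr.1
    · intro r hr; simp only [mem_filter, mem_gcdFs] at hr; exact hr.1
    · intro r hr s hs
      simp only [mem_filter, mem_gcdFs] at hr hs
      rw [mem_sdiff, key1 r hr.1 s hs.1, key2 r hr.1 s hs.1]
      exact ⟨hs.2, hr.2⟩
  · refine gcd_fiber H₁ H₂ c _ _ _ ?_ ?_ ?_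
    · intro r hr; simp only [mem_filter, mem_gcdFs] at hr; exact hr.1
    · intro r hr; simp only [mem_filter, mem_gcdFs] at hr; exact hr.1
    · intro r hr s hs
      simp only [mem_filter, mem_gcdFs] at hr hs
      rw [mem_sdiff, key1 r hr.1 s hs.1, key2 r hr.1 s hs.1]
      exact ⟨hr.2, hs.2⟩

/-- `C` has a group of periods `H` with `N ≤ |C| + |H|`. -/
def gcdP (N : ℕ) (C : Finset G) : Prop :=
  ∃ H : AddSubgroup G, gcdPer C H ∧ N ≤ C.card + (gcdFs H).card

lemma gcdP_union_wlog (N : ℕ) (C₁ C₂ : Finset G) (H₁ H₂ : AddSubgroup G) (h₁ : gcdPer C₁ H₁)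
    (h₂ : gcdPer C₂ H₂) (n₁ : N ≤ C₁.card + (gcdFs H₁).card)
    (n₂ : N ≤ C₂.card + (gcdFs H₂).card)
    (hle : (gcdFs H₁).card ≤ (gcdFs H₂).card) : gcdP N (C₁ ∪ C₂) := by
  by_cases hsub : C₂ ⊆ C₁
  · rw [union_eq_left.2 hsub]; exact ⟨H₁, h₁, n₁⟩
  obtain ⟨c, hc2, hc1⟩ := not_subset.1 hsub
  refine ⟨H₁ ⊓ H₂, ?_, ?_⟩
  · intro h hh x hx
    rw [mem_union] at hx ⊢
    exact hx.imp (h₁ h hh.1 x) (h₂ h hh.2 x)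
  · have e1 : (C₁ ∪ C₂).card = (C₂ \ C₁).card + C₁.card := by
      rw [union_comm]; exact (card_sdiff_add_card C₂ C₁).symm
    have e2 : (C₁ ∪ C₂).card = (C₁ \ C₂).card + C₂.card := (card_sdiff_add_card C₁ C₂).symm
    rcases gcd_union_aux C₁ C₂ H₁ H₂ h₁ h₂ hle c hc2 hc1 with h | h <;> omega

lemma gcdP_union (N : ℕ) (C₁ C₂ : Finset G) (h₁ : gcdP N C₁) (h₂ : gcdP N C₂) :
    gcdP N (C₁ ∪ C₂) := by
  obtain ⟨H₁, h₁, n₁⟩ := h₁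
  obtain ⟨H₂, h₂, n₂⟩ := h₂
  rcases le_total (gcdFs H₁).card (gcdFs H₂).card with h | h
  · exact gcdP_union_wlog N C₁ C₂ H₁ H₂ h₁ h₂ n₁ n₂ h
  · rw [union_comm]; exact gcdP_union_wlog N C₂ C₁ H₂ H₁ h₂ h₁ n₂ n₁ h

lemma gcdP_zero (j : ℕ) : ∀ (A B : Finset G), B.card = j → (0 : G) ∈ B → ∀ a ∈ A,
    ∃ C ⊆ A + B, a ∈ C ∧ gcdP (A.card + B.card) C := by
  induction j using Nat.strong_induction_on with
  | _ j ih =>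
    intro A B hj h0 a ha
    by_cases hall : ∀ e ∈ A, ∀ b ∈ B, e + b ∈ A
    · refine ⟨A, fun x hx => ?_, ha, AddSubgroup.closure (B : Set G), ?_, ?_⟩
      · simpa using add_mem_add hx h0
      · intro h hh
        have key : ∀ h ∈ AddSubmonoid.closure (B : Set G), ∀ x ∈ A, x + h ∈ A := by
          intro h hh
          induction hh using AddSubmonoid.closure_induction with
          | mem b hb => exact fun x hx => hall x hx b hb
          | zero => simp
          | add u v _ _ hu hv => intro x hx; rw [← add_assoc]; exact hv _ (hu _ hx)
        apply key
        rw [← AddSubgroup.closure_toAddSubmonoid_of_finite]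
        exact hh
      · refine Nat.add_le_add_left (card_le_card fun b hb => ?_) _
        rw [mem_gcdFs]
        exact AddSubgroup.subset_closure hb
    · push Not at hall
      obtain ⟨e, he, b, hb, heb⟩ := hall
      let A' := A ∪ B.image (fun x => e + x)
      let B' := B.filter (fun x => e + x ∈ A)
      have hB' : B'.card < B.card := by
        apply card_lt_card
        rw [filter_ssubset]
        exact ⟨b, hb, heb⟩
      have hcard : A'.card + B'.card = A.card + B.card := by
        have h1 : A'.card + (A ∩ B.image (fun x => e + x)).card
          = A.card + (B.image (fun x => e + x)).card := card_union_add_card_inter _ _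
        have h2 : (B.image (fun x => e + x)).card = B.card :=
          card_image_of_injective _ (add_right_injective e)
        have h3 : A ∩ B.image (fun x => e + x) = B'.image (fun x => e + x) := by
          ext y
          simp only [B', mem_inter, mem_image, mem_filter]
          constructor
          · rintro ⟨hy, x, hx, rfl⟩; exact ⟨x, ⟨hx, hy⟩, rfl⟩
          · rintro ⟨x, ⟨hx, hy⟩, rfl⟩; exact ⟨hy, x, hx, rfl⟩
        rw [h3, card_image_of_injective _ (add_right_injective e)] at h1
        omega
      obtain ⟨C, hC, haC, hP⟩ := ih B'.card (hj ▸ hB') A' B' rfl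
        (by simp [B', h0, he]) a (mem_union_left _ ha)
      refine ⟨C, hC.trans ?_, haC, hcard ▸ hP⟩
      intro z hz
      obtain ⟨x, hx, y, hy, rfl⟩ := mem_add.1 hz
      simp only [A', B', mem_union, mem_image, mem_filter] at hx hy
      rcases hx with hx | ⟨x, hx, rfl⟩
      · exact add_mem_add hx hy.1
      · rw [add_right_comm]; exact add_mem_add hy.2 hx

lemma gcdP_point (A B : Finset G) (c : G) (hc : c ∈ A + B) :
    ∃ C ⊆ A + B, c ∈ C ∧ gcdP (A.card + B.card) C := by
  obtain ⟨a, ha, b, hb, rfl⟩ := mem_add.1 hc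
  have hA : (A.image (fun x => x + b)).card = A.card :=
    card_image_of_injective _ (add_left_injective b)
  have hB : (B.image (fun x => x - b)).card = B.card :=
    card_image_of_injective _ sub_left_injective
  have hs : A.image (fun x => x + b) + B.image (fun x => x - b) ⊆ A + B := by
    intro z hz
    obtain ⟨x, hx, y, hy, rfl⟩ := mem_add.1 hz
    obtain ⟨x', hx', rfl⟩ := mem_image.1 hx
    obtain ⟨y', hy', rfl⟩ := mem_image.1 hy
    rw [add_add_sub_cancel]
    exact add_mem_add hx' hy'
  obtain ⟨C, hC, h1, h2⟩ := gcdP_zero _ (A.image (fun x => x + b)) (B.image (fun x => x - b)) rfl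
    (mem_image.2 ⟨b, hb, sub_self b⟩) (a + b) (mem_image.2 ⟨a, ha, rfl⟩)
  rw [hA, hB] at h2
  exact ⟨C, hC.trans hs, h1, h2⟩

/-- Kneser's theorem. -/
lemma gcdP_add (A B : Finset G) (hA : A.Nonempty) (hB : B.Nonempty) :
    gcdP (A.card + B.card) (A + B) := by
  have key : ∀ S ⊆ A + B, S.Nonempty → ∃ C ⊆ A + B, S ⊆ C ∧ gcdP (A.card + B.card) C := by
    intro S
    induction S using Finset.induction_on with
    | empty => intro _ h; exact absurd h (by simp)
    | insert c S _ ih =>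
      intro hS _
      obtain ⟨C, hC, hc, hP⟩ := gcdP_point A B c (hS (mem_insert_self _ _))
      rcases S.eq_empty_or_nonempty with rfl | hne
      · exact ⟨C, hC, by simpa using hc, hP⟩
      · obtain ⟨C', hC', hc', hP'⟩ := ih (fun x hx => hS (mem_insert_of_mem hx)) hne
        refine ⟨C ∪ C', union_subset hC hC', ?_, gcdP_union _ _ _ hP hP'⟩
        exact insert_subset (mem_union_left _ hc) (hc'.trans subset_union_right)
  obtain ⟨C, h1, h2, h3⟩ := key _ subset_rfl (hA.add hB)
  rwa [subset_antisymm h1 h2] at h3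

/-- The stabilizer. -/
def gcdStab (C : Finset G) : AddSubgroup G where
  carrier := {h | ∀ x, x + h ∈ C ↔ x ∈ C}
  zero_mem' := by simp
  add_mem' := by
    intro a b ha hb x
    rw [← add_assoc, hb, ha]
  neg_mem' := by
    intro a ha x
    rw [← ha (x + -a)]; simp

omit [Fintype G] [DecidableEq G] in
lemma gcdPer.le_stab {C : Finset G} {H : AddSubgroup G} (h : gcdPer C H) : H ≤ gcdStab C :=
  fun _ hx _ => h.iff hx

lemma gcdFs_add_self (H : AddSubgroup G) : gcdFs H + gcdFs H = gcdFs H := by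
  ext x
  rw [mem_add]
  constructor
  · rintro ⟨a, ha, b, hb, rfl⟩
    rw [mem_gcdFs] at *
    exact H.add_mem ha hb
  · intro hx
    exact ⟨x, hx, 0, by simp [mem_gcdFs], by simp⟩

lemma gcd_multi {ι : Type*} [Fintype ι] (A : ι → Finset G) (hA : ∀ i, (A i).Nonempty) :
    ∃ H : AddSubgroup G, ∑ i, (A i + gcdFs H).card + (gcdFs H).card
      ≤ (∑ i, A i).card + Fintype.card ι * (gcdFs H).card := by
  classical
  let H := gcdStab (∑ i, A i)
  have hHne : (gcdFs H).Nonempty := ⟨0, by simp [mem_gcdFs]⟩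
  have hfull : gcdFs H + ∑ i, A i = ∑ i, A i := by
    ext x
    constructor
    · intro hx
      obtain ⟨h, hh, y, hy, rfl⟩ := mem_add.1 hx
      rw [add_comm]
      exact ((mem_gcdFs _ _).1 hh y).2 hy
    · intro hx
      exact mem_add.2 ⟨0, by simp [mem_gcdFs], x, hx, by simp⟩
  refine ⟨H, ?_⟩
  have key : ∀ s : Finset ι, (gcdFs H + ∑ i ∈ s, A i).Nonempty ∧
      ∑ i ∈ s, (A i + gcdFs H).card + (gcdFs H).card
      ≤ (gcdFs H + ∑ i ∈ s, A i).card + s.card * (gcdFs H).card := by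
    intro s
    induction s using Finset.induction_on with
    | empty => simp [hHne]
    | insert j s hj ih =>
      obtain ⟨hne, ih⟩ := ih
      have hAj : (A j + gcdFs H).Nonempty := (hA j).add hHne
      have e : (gcdFs H + ∑ i ∈ s, A i) + (A j + gcdFs H) = gcdFs H + ∑ i ∈ insert j s, A i := by
        rw [sum_insert hj]
        conv_rhs => rw [← gcdFs_add_self]
        abel
      obtain ⟨K, hK, hN⟩ := gcdP_add _ _ hne hAj
      rw [e] at hK hN
      have hKH : K ≤ H := by
        apply gcdPer.le_stab
        intro k hk x hx
        have e2 : (gcdFs H + ∑ i ∈ insert j s, A i) + ∑ i ∈ (insert j s)ᶜ, A i = ∑ i, A i := by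
          rw [add_assoc, sum_add_sum_compl, hfull]
        rw [← e2] at hx ⊢
        obtain ⟨u, hu, v, hv, rfl⟩ := mem_add.1 hx
        rw [add_right_comm u v k]
        exact add_mem_add (hK k hk u hu) hv
      have hc : (gcdFs K).card ≤ (gcdFs H).card := card_le_card fun x hx => by
        rw [mem_gcdFs] at *; exact hKH hx
      refine ⟨e ▸ hne.add hAj, ?_⟩
      rw [sum_insert hj, card_insert_of_notMem hj, add_mul, one_mul]
      omega
  have := (key univ).2
  rwa [hfull] at this

lemma gcd_dvd (H : AddSubgroup G) (A : Finset G) : (gcdFs H).card ∣ (A + gcdFs H).card := by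
  refine Finset.card_dvd_card_add_right ?_
  rintro X ⟨a, _, rfl⟩ Y ⟨b, _, rfl⟩ hne
  rw [Function.onFun, id, id, Finset.disjoint_left]
  intro x hx hy
  apply hne
  simp only [mem_vadd_finset, mem_gcdFs] at hx hy
  obtain ⟨h, hh, rfl⟩ := hx
  obtain ⟨k, hk, e⟩ := hy
  simp only [vadd_eq_add] at e
  have hab : a = b + (k - h) := by
    rw [← add_sub_assoc, e, add_sub_cancel_right]
  have hkh : k - h ∈ H := H.sub_mem hk hh
  ext x
  simp only [mem_vadd_finset, mem_gcdFs, vadd_eq_add]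
  constructor
  · rintro ⟨y, hy, rfl⟩
    exact ⟨(k - h) + y, H.add_mem hkh hy, by rw [hab, add_assoc]⟩
  · rintro ⟨y, hy, rfl⟩
    exact ⟨y - (k - h), H.sub_mem hy hkh, by rw [hab]; abel⟩

end GCD

/-- Generalized Cauchy–Davenport theorem over ℤ_n, divisor form. -/
theorem generalized_cauchy_davenport_divisor
    (n k : ℕ) (hn : 0 < n) (hk : 1 ≤ k)
    (A : Fin k → Finset (ZMod n)) (hA : ∀ i, (A i).Nonempty) :
    ((∑ i, A i).card : ℤ) ≥
      n.divisors.inf' (Nat.nonempty_divisors.mpr hn.ne')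
        (fun d => (d : ℤ) * (∑ i, ⌈((A i).card : ℚ) / (d : ℚ)⌉ - ((k : ℤ) - 1))) := by
  have : NeZero n := ⟨hn.ne'⟩
  obtain ⟨H, hH⟩ := gcd_multi A hA
  have hpos : 0 < (gcdFs H).card := Finset.card_pos.2 ⟨0, by simp [mem_gcdFs]⟩
  have hd : (gcdFs H).card ∣ n := by
    have h := gcd_dvd H Finset.univ
    have e : (Finset.univ + gcdFs H : Finset (ZMod n)) = Finset.univ := by
      ext x
      simp only [Finset.mem_univ, iff_true]
      exact Finset.mem_add.2 ⟨x, Finset.mem_univ _, 0, by simp [mem_gcdFs], by simp⟩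
    rwa [e, Finset.card_univ, ZMod.card] at h
  refine le_trans (Finset.inf'_le _ (Nat.mem_divisors.2 ⟨hd, hn.ne'⟩)) ?_
  have hi : ∀ i, ((gcdFs H).card : ℤ) * ⌈((A i).card : ℚ) / ((gcdFs H).card : ℚ)⌉
      ≤ ((A i + gcdFs H).card : ℤ) := by
    intro i
    obtain ⟨q, hq⟩ := gcd_dvd H (A i)
    have hle : (A i).card ≤ (A i + gcdFs H).card := Finset.card_le_card fun x hx =>
      Finset.mem_add.2 ⟨x, hx, 0, by simp [mem_gcdFs], by simp⟩
    rw [hq] at hle ⊢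
    push_cast
    refine mul_le_mul_of_nonneg_left ?_ (by positivity)
    rw [Int.ceil_le, div_le_iff₀ (by exact_mod_cast hpos)]
    push_cast
    rw [mul_comm]
    exact_mod_cast hle
  have hsum := Finset.sum_le_sum (fun i (_ : i ∈ Finset.univ) => hi i)
  rw [← Finset.mul_sum] at hsum
  rw [Fintype.card_fin] at hH
  have hH' : ∑ i, ((A i + gcdFs H).card : ℤ) + (gcdFs H).card
      ≤ ((∑ i, A i).card : ℤ) + k * (gcdFs H).card := by exact_mod_cast hH
  linarith
end

section
/- Let n be a positive integer, let k ≥ 1, and let A_1, A_2, …, A_k be nonempty finite subsets of the additive group ℤ_n of integers modulo n. Let H be the stabilizer of the sumset A_1 + A_2 + ⋯ + A_k in ℤ_n. Then |A_1 + A_2 + ⋯ + A_k| ≥ |A_1 + H| + |A_2 + H| + ⋯ + |A_k + H| − (k − 1)|H|. -/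
open Pointwise

namespace KnAux
open Finset

variable {G : Type*} [AddCommGroup G] [Fintype G] [DecidableEq G]

open Classical in
/-- stabilizer as a finset -/
noncomputable def st (C : Finset G) : Finset G :=
  univ.filter (fun h => h ∈ AddAction.stabilizer G C)

lemma mem_st {C : Finset G} {h : G} : h ∈ st C ↔ ∀ x ∈ C, h + x ∈ C := by
  simp only [st, mem_filter, mem_univ, true_and]
  exact AddAction.mem_stabilizer_finset'

lemma mem_st_iff {C : Finset G} {h : G} (hh : h ∈ st C) (x : G) : h + x ∈ C ↔ x ∈ C := by
  simp only [st, mem_filter, mem_univ, true_and] at hh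
  exact AddAction.mem_stabilizer_finset.1 hh x

lemma st_zero (C : Finset G) : (0 : G) ∈ st C := by simp [mem_st]

lemma st_add {C : Finset G} {a b : G} (ha : a ∈ st C) (hb : b ∈ st C) : a + b ∈ st C := by
  simp only [st, mem_filter, mem_univ, true_and] at *
  exact add_mem ha hb

lemma st_sub {C : Finset G} {a b : G} (ha : a ∈ st C) (hb : b ∈ st C) : a - b ∈ st C := by
  simp only [st, mem_filter, mem_univ, true_and] at *
  exact sub_mem ha hb

lemma card_prod (C D P Q : Finset G) (hP : P ⊆ st C) (hQ : Q ⊆ st D) :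
    P.card * Q.card ≤ (st C ∩ st D).card * (P + Q).card := by
  rw [← card_product]
  have : P + Q = (P ×ˢ Q).image (fun z => z.1 + z.2) := rfl
  rw [this]
  apply card_le_mul_card_image
  intro z hz
  obtain ⟨⟨p0, q0⟩, h0, rfl⟩ := mem_image.1 hz
  rw [mem_product] at h0
  apply card_le_card_of_injOn (fun z => z.1 - p0)
  · rintro ⟨p, q⟩ hpq
    simp only [coe_filter, mem_product, Set.mem_setOf_eq] at hpq
    obtain ⟨⟨hp, hq⟩, he⟩ := hpq
    simp only [coe_inter, Set.mem_inter_iff, mem_coe]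
    refine ⟨st_sub (hP hp) (hP h0.1), ?_⟩
    have : p - p0 = q0 - q := by
      rw [sub_eq_sub_iff_add_eq_add, he, add_comm]
    rw [this]
    exact st_sub (hQ h0.2) (hQ hq)
  · rintro ⟨p, q⟩ hpq ⟨p', q'⟩ hpq' h
    simp only [coe_filter, mem_product, Set.mem_setOf_eq] at hpq hpq'
    have h1 : p = p' := by simpa using h
    subst h1
    have := hpq.2.trans hpq'.2.symm
    simp at this
    simp [this]

lemma card_ge (K P : Finset G) (hP : ∀ p ∈ P, ∀ k ∈ K, k + p ∈ P) :
    P.card = 0 ∨ K.card ≤ P.card := by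
  rcases P.eq_empty_or_nonempty with rfl | ⟨p, hp⟩
  · simp
  · right
    apply card_le_card_of_injOn (fun k => k + p)
    · intro k hk
      exact hP p hp k hk
    · intro a _ b _ h
      simpa using h

lemma grid (C D : Finset G) (x : G) (hx : x ∈ C) (hx' : x ∉ D) :
    ∃ u a v b : ℕ, u + a = (st D).card ∧ v + b = (st C).card ∧
      (st C ∩ st D).card ≤ u ∧ (st C ∩ st D).card ≤ b ∧
      (a = 0 ∨ (st C ∩ st D).card ≤ a) ∧ (v = 0 ∨ (st C ∩ st D).card ≤ v) ∧
      u * b ≤ (st C ∩ st D).card * (C \ D).card ∧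
      v * a ≤ (st C ∩ st D).card * (D \ C).card := by
  have key : ∀ k ∈ st C ∩ st D, k ∈ st C ∧ k ∈ st D := fun k hk => mem_inter.1 hk
  refine ⟨((st D).filter (fun h => h + x ∈ C)).card, ((st D).filter (fun h => ¬ h + x ∈ C)).card,
    ((st C).filter (fun h => h + x ∈ D)).card, ((st C).filter (fun h => ¬ h + x ∈ D)).card,
    card_filter_add_card_filter_not _, card_filter_add_card_filter_not _, ?_, ?_, ?_, ?_, ?_, ?_⟩
  · apply card_le_card
    intro k hk
    obtain ⟨h1, h2⟩ := key k hk
    simp [h2, mem_st_iff h1, hx]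
  · apply card_le_card
    intro k hk
    obtain ⟨h1, h2⟩ := key k hk
    simp [h1, mem_st_iff h2, hx']
  · apply card_ge
    intro p hp k hk
    obtain ⟨h1, h2⟩ := key k hk
    rw [mem_filter] at hp ⊢
    refine ⟨st_add h2 hp.1, ?_⟩
    rw [add_assoc, mem_st_iff h1]; exact hp.2
  · apply card_ge
    intro p hp k hk
    obtain ⟨h1, h2⟩ := key k hk
    rw [mem_filter] at hp ⊢
    refine ⟨st_add h1 hp.1, ?_⟩
    rw [add_assoc, mem_st_iff h2]; exact hp.2
  · rw [mul_comm]
    refine (card_prod C D _ _ (filter_subset _ _) (filter_subset _ _)).trans ?_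
    apply Nat.mul_le_mul_left
    apply card_le_card_of_injOn (fun k => k + x)
    · intro z hz
      obtain ⟨c, hc, d, hd, rfl⟩ := mem_add.1 (mem_coe.1 hz)
      rw [mem_filter] at hc hd
      simp only [mem_coe, mem_sdiff]
      constructor
      · rw [add_assoc, mem_st_iff hc.1]; exact hd.2
      · rw [add_comm c d, add_assoc, mem_st_iff hd.1]; exact hc.2
    · intro a _ b _ h
      simpa using h
  · refine (card_prod C D _ _ (filter_subset _ _) (filter_subset _ _)).trans ?_
    apply Nat.mul_le_mul_left
    apply card_le_card_of_injOn (fun k => k + x)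
    · intro z hz
      obtain ⟨c, hc, d, hd, rfl⟩ := mem_add.1 (mem_coe.1 hz)
      rw [mem_filter] at hc hd
      simp only [mem_coe, mem_sdiff]
      constructor
      · rw [add_comm c d, add_assoc, mem_st_iff hd.1]; exact hc.2
      · rw [add_assoc, mem_st_iff hc.1]; exact hd.2
    · intro a _ b _ h
      simpa using h

/-- arithmetic: from one grid -/
lemma arith (h u a v b X Y : ℕ) (hh : 0 < h) (hu : h ≤ u) (hb : h ≤ b)
    (ha : a = 0 ∨ h ≤ a) (hv : v = 0 ∨ h ≤ v) (h1 : u * b ≤ h * X) (h2 : v * a ≤ h * Y) :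
    u + a ≤ X + h ∨ v + b ≤ Y + h ∨ v + b ≤ X := by
  rcases ha with rfl | ha
  · left
    have : h * u ≤ h * X := by nlinarith
    have := Nat.le_of_mul_le_mul_left this hh
    omega
  rcases hv with rfl | hv
  · right; right
    have : h * b ≤ h * X := by nlinarith
    have := Nat.le_of_mul_le_mul_left this hh
    omega
  by_contra! hc
  obtain ⟨c1, c2, -⟩ := hc
  obtain ⟨u, rfl⟩ := Nat.exists_eq_add_of_le hu
  obtain ⟨a, rfl⟩ := Nat.exists_eq_add_of_le ha
  obtain ⟨b, rfl⟩ := Nat.exists_eq_add_of_le hb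
  obtain ⟨v, rfl⟩ := Nat.exists_eq_add_of_le hv
  have e1 : h * X < h * (h + u + a) := Nat.mul_lt_mul_of_pos_left (by omega) hh
  have e2 : h * Y < h * (h + v + b) := Nat.mul_lt_mul_of_pos_left (by omega) hh
  have f1 : h * b < h * a := by nlinarith [Nat.zero_le (u * b)]
  have f2 : h * a < h * b := by nlinarith [Nat.zero_le (v * a)]
  omega

lemma two_union (C D : Finset G) (N : ℕ) (hC : N ≤ C.card + (st C).card)
    (hD : N ≤ D.card + (st D).card) : N ≤ (C ∪ D).card + (st (C ∪ D)).card := by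
  by_cases hCD : C ⊆ D
  · rwa [union_eq_right.2 hCD]
  by_cases hDC : D ⊆ C
  · rwa [union_eq_left.2 hDC]
  obtain ⟨x, hx, hx'⟩ := not_subset.1 hCD
  obtain ⟨y, hy, hy'⟩ := not_subset.1 hDC
  have hK : st C ∩ st D ⊆ st (C ∪ D) := by
    intro k hk
    obtain ⟨h1, h2⟩ := mem_inter.1 hk
    rw [mem_st]
    intro z hz
    rw [mem_union] at hz ⊢
    rwa [mem_st_iff h1, mem_st_iff h2]
  have hKc := card_le_card hK
  have hpos : 0 < (st C ∩ st D).card :=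
    card_pos.2 ⟨0, mem_inter.2 ⟨st_zero _, st_zero _⟩⟩
  have k1 : (C ∪ D).card = C.card + (D \ C).card := by
    rw [add_comm, card_sdiff_add_card, union_comm]
  have k2 : (C ∪ D).card = D.card + (C \ D).card := by
    rw [add_comm, card_sdiff_add_card]
  obtain ⟨u, a, v, b, e1, e2, g1, g2, g3, g4, g5, g6⟩ := grid C D x hx hx'
  obtain ⟨u', a', v', b', e1', e2', g1', g2', g3', g4', g5', g6'⟩ := grid D C y hy hy'
  rw [inter_comm (st D)] at g1' g2' g3' g4' g5' g6'
  have r1 := arith _ u a v b _ _ hpos g1 g2 g3 g4 g5 g6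
  have r2 := arith _ u' a' v' b' _ _ hpos g1' g2' g3' g4' g5' g6'
  omega

lemma big_union {ι : Type*} (s : Finset ι) (hs : s.Nonempty) (f : ι → Finset G) (N : ℕ)
    (h : ∀ i ∈ s, N ≤ (f i).card + (st (f i)).card) :
    N ≤ (s.biUnion f).card + (st (s.biUnion f)).card := by
  classical
  induction hs using Finset.Nonempty.cons_induction with
  | singleton a => simpa using h
  | cons a s ha hs ih =>
    rw [cons_eq_insert, biUnion_insert]
    apply two_union
    · exact h a (by simp)
    · exact ih fun i hi => h i (by simp [hi])

lemma dyson (m : ℕ) : ∀ (A B : Finset G), B.card = m → ∀ a ∈ A, (0 : G) ∈ B →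
    ∃ C : Finset G, a ∈ C ∧ C ⊆ A + B ∧ A.card + B.card ≤ C.card + (st C).card := by
  induction m using Nat.strong_induction_on with
  | _ m ih =>
  intro A B hB a ha h0
  by_cases hall : ∀ e ∈ A, ∀ b ∈ B, e + b ∈ A
  · refine ⟨A, ha, fun x hx => mem_add.2 ⟨x, hx, 0, h0, add_zero x⟩, ?_⟩
    apply Nat.add_le_add_left
    apply card_le_card
    intro b hb
    rw [mem_st]
    intro x hx
    rw [add_comm]
    exact hall x hx b hb
  · push Not at hall
    obtain ⟨e, he, b, hb, hn⟩ := hall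
    have hsub := addDysonETransform.subset e (A, B)
    have hcard := addDysonETransform.card e (A, B)
    simp only [addDysonETransform] at hsub hcard
    have hlt : (B ∩ (-e +ᵥ A)).card < m := by
      rw [← hB]
      apply card_lt_card
      refine ⟨inter_subset_left, fun hh => hn ?_⟩
      have := (mem_inter.1 (hh hb)).2
      obtain ⟨z, hz, hzz⟩ := mem_vadd_finset.1 this
      rw [← hzz]
      simpa using hz
    obtain ⟨C, h1, h2, h3⟩ := ih _ hlt (A ∪ (e +ᵥ B)) (B ∩ (-e +ᵥ A)) rfl a
      (mem_union_left _ ha) (mem_inter.2 ⟨h0, mem_vadd_finset.2 ⟨e, he, by simp⟩⟩)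
    exact ⟨C, h1, h2.trans hsub, by omega⟩

lemma st_vadd (C : Finset G) (b : G) : st (b +ᵥ C) = st C := by
  have key : ∀ (C : Finset G) (b : G), st C ⊆ st (b +ᵥ C) := by
    intro C b h hh
    rw [mem_st]
    intro x hx
    obtain ⟨z, hz, rfl⟩ := mem_vadd_finset.1 hx
    refine mem_vadd_finset.2 ⟨h + z, mem_st.1 hh z hz, ?_⟩
    simp only [vadd_eq_add]; abel
  apply Subset.antisymm _ (key C b)
  have := key (b +ᵥ C) (-b)
  rwa [neg_vadd_vadd] at this

lemma kneser2 (A B : Finset G) (hA : A.Nonempty) (hB : B.Nonempty) :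
    A.card + B.card ≤ (A + B).card + (st (A + B)).card := by
  have key : ∀ c : G, ∃ C : Finset G, c ∈ A + B → c ∈ C ∧ C ⊆ A + B ∧
      A.card + B.card ≤ C.card + (st C).card := by
    intro c
    by_cases hc : c ∈ A + B
    · obtain ⟨a, ha, b, hb, rfl⟩ := mem_add.1 hc
      obtain ⟨C, h1, h2, h3⟩ := dyson _ A (-b +ᵥ B) rfl a ha
        (mem_vadd_finset.2 ⟨b, hb, by simp⟩)
      refine ⟨b +ᵥ C, fun _ => ⟨mem_vadd_finset.2 ⟨a, h1, by simp [add_comm]⟩, ?_, ?_⟩⟩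
      · intro z hz
        obtain ⟨c, hc, rfl⟩ := mem_vadd_finset.1 hz
        obtain ⟨a', ha', y, hy, rfl⟩ := mem_add.1 (h2 hc)
        obtain ⟨b', hb', rfl⟩ := mem_vadd_finset.1 hy
        refine mem_add.2 ⟨a', ha', b', hb', ?_⟩
        simp only [vadd_eq_add]; abel
      · rw [st_vadd, card_vadd_finset]
        rwa [card_vadd_finset] at h3
    · exact ⟨∅, fun h => absurd h hc⟩
  choose f hf using key
  have hU : (A + B).biUnion f = A + B := by
    apply Subset.antisymm
    · exact biUnion_subset.2 fun c hc => (hf c hc).2.1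
    · intro c hc
      exact mem_biUnion.2 ⟨c, hc, (hf c hc).1⟩
  have := big_union (A + B) (hA.add hB) f (A.card + B.card) fun c hc => (hf c hc).2.2
  rwa [hU] at this

lemma kfold {ι : Type*} [DecidableEq ι] (K : Finset G) (hK0 : (0 : G) ∈ K) (hKK : K + K = K)
    (s : Finset ι) (A : ι → Finset G) (hA : ∀ i, (A i).Nonempty)
    (hst : st (∑ i ∈ s, A i + K) ⊆ K) :
    ∑ i ∈ s, (A i + K).card + K.card ≤ (∑ i ∈ s, A i + K).card + s.card * K.card := by
  induction s using Finset.induction_on with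
  | empty => simp
  | insert a s ha ih =>
    have hne : ∀ s : Finset ι, (∑ i ∈ s, A i).Nonempty := by
      intro s
      induction s using Finset.induction_on with
      | empty => simp
      | insert b s hb ih => rw [sum_insert hb]; exact (hA b).add ih
    have hKn : K.Nonempty := ⟨0, hK0⟩
    have hT : ∑ i ∈ insert a s, A i + K = (A a + K) + (∑ i ∈ s, A i + K) := by
      rw [sum_insert ha, add_add_add_comm, hKK]
    rw [hT] at hst ⊢
    have h2 := kneser2 (A a + K) (∑ i ∈ s, A i + K) ((hA a).add hKn) ((hne s).add hKn)
    have hc := card_le_card hst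
    have := ih (by
      refine Subset.trans ?_ hst
      intro h hh
      rw [mem_st]
      intro x hx
      obtain ⟨p, hp, q, hq, rfl⟩ := mem_add.1 hx
      refine mem_add.2 ⟨p, hp, h + q, mem_st.1 hh q hq, by abel⟩)
    rw [sum_insert ha, card_insert_of_notMem ha, add_mul, one_mul]
    omega

end KnAux

/-- k-fold generalization of Kneser's additive theorem over ℤ_n. -/
theorem kneser_kfold
    (n k : ℕ) (hn : 0 < n) (hk : 1 ≤ k)
    (A : Fin k → Finset (ZMod n)) (hA : ∀ i, (A i).Nonempty)
    (H : Finset (ZMod n))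
    (hH : ∀ h : ZMod n,
      h ∈ H ↔ Finset.image (fun x => h + x) (∑ i, A i) = ∑ i, A i) :
    ((∑ i, A i).card : ℤ) ≥
      ∑ i, ((A i + H).card : ℤ) - ((k : ℤ) - 1) * (H.card : ℤ) := by
  haveI : NeZero n := ⟨hn.ne'⟩
  have hHs : H = KnAux.st (∑ i, A i) := by
    ext h
    rw [hH, KnAux.mem_st]
    constructor
    · intro e x hx
      rw [← e]
      exact Finset.mem_image_of_mem _ hx
    · intro e
      apply Finset.eq_of_subset_of_card_le
      · intro z hz
        obtain ⟨x, hx, rfl⟩ := Finset.mem_image.1 hz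
        exact e x hx
      · rw [Finset.card_image_of_injective _ (add_right_injective h)]
  have h0 : (0 : ZMod n) ∈ H := by rw [hHs]; exact KnAux.st_zero _
  have hHH : H + H = H := by
    apply Finset.Subset.antisymm
    · intro z hz
      obtain ⟨a, ha, b, hb, rfl⟩ := Finset.mem_add.1 hz
      rw [hHs] at *
      exact KnAux.st_add ha hb
    · intro z hz
      exact Finset.mem_add.2 ⟨z, hz, 0, h0, add_zero z⟩
  have hS : ∑ i, A i + H = ∑ i, A i := by
    apply Finset.Subset.antisymm
    · intro z hz
      obtain ⟨a, ha, b, hb, rfl⟩ := Finset.mem_add.1 hz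
      rw [hHs] at hb
      rw [add_comm]
      exact KnAux.mem_st.1 hb a ha
    · intro z hz
      exact Finset.mem_add.2 ⟨z, hz, 0, h0, add_zero z⟩
  have := KnAux.kfold H h0 hHH Finset.univ A hA (by rw [hS, ← hHs])
  rw [hS, Finset.card_univ, Fintype.card_fin] at this
  zify at this
  linarith
end

section
/- Let F be a finite field of order q, let ω ≥ 3 be an integer, and let d_1, …, d_ω be integers each at least 2. Then the tuple (d_1, …, d_ω) is realizable over F if and only if there exist subsets T_1, T_2, …, T_ω of the additive group ℤ_{q−1} of integers modulo q−1 with |T_i| = d_i for each i such that the sumset T_1 + T_2 + ⋯ + T_ω = {b_1 + ⋯ + b_ω : b_j ∈ T_j for each j} does not exhaust ℤ_{q−1}, i.e. |T_1 + T_2 + ⋯ + T_ω| < q − 1. -/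
open Pointwise

/-- `Realizable F ω d` : there are subsets `S i ⊆ F \ {0}` with `|S i| = d i` such that
`(-1)^(ω-1)` is not in the product set `S 1 ⋯ S ω`. -/
def Realizable (F : Type*) [Field F] (ω : ℕ) (d : Fin ω → ℕ) : Prop :=
  ∃ S : Fin ω → Finset F,
    (∀ i, (0 : F) ∉ S i) ∧ (∀ i, (S i).card = d i) ∧
    ∀ a : Fin ω → F, (∀ i, a i ∈ S i) → (-1 : F) ^ (ω - 1) ≠ ∏ i, a i

lemma aux_mem {n ω : ℕ} (T : Fin ω → Finset (ZMod n)) (c : ZMod n) :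
    c ∈ ∑ i, T i ↔ ∃ g : Fin ω → ZMod n, (∀ i, g i ∈ T i) ∧ ∑ i, g i = c := by
  rw [← Finset.mem_coe, Finset.coe_sum, Set.mem_fintype_sum]
  constructor
  · rintro ⟨g, hg, h⟩
    exact ⟨g, fun i => by simpa using hg i, h⟩
  · rintro ⟨g, hg, h⟩
    exact ⟨g, fun i => by simpa using hg i, h⟩

theorem realizable_iff_sumset_not_exhaust
    (F : Type) [Field F] [Fintype F] (q : ℕ) (hq : Fintype.card F = q)
    (ω : ℕ) (hω : 3 ≤ ω) (d : Fin ω → ℕ) (hd : ∀ i, 2 ≤ d i) :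
    Realizable F ω d ↔
      ∃ T : Fin ω → Finset (ZMod (q - 1)),
        (∀ i, (T i).card = d i) ∧ (∑ i, T i).card < q - 1 := by
  classical
  have hq2 : 1 < q := hq ▸ Fintype.one_lt_card
  have hcard : Nat.card Fˣ = q - 1 := by
    rw [Nat.card_eq_fintype_card, Fintype.card_units, hq]
  generalize q - 1 = n at *
  have hn : n ≠ 0 := by rw [← hcard]; exact Nat.card_pos.ne'
  have : NeZero n := ⟨hn⟩
  obtain ⟨e⟩ : Nonempty (Multiplicative (ZMod n) ≃* Fˣ) := by
    rw [← hcard]; exact ⟨zmodCyclicMulEquiv inferInstance⟩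
  obtain ⟨f, hinj, hsurj, hne, hsum⟩ : ∃ f : ZMod n → F, Function.Injective f ∧
      (∀ y, y ≠ 0 → ∃ x, f x = y) ∧ (∀ x, f x ≠ 0) ∧
      (∀ g : Fin ω → ZMod n, f (∑ i, g i) = ∏ i, f (g i)) := by
    refine ⟨fun x => (e (Multiplicative.ofAdd x) : F), ?_, ?_, ?_, ?_⟩
    · intro x y h
      exact Multiplicative.ofAdd.injective (e.injective (Units.ext h))
    · intro y hy
      exact ⟨(e.symm (Units.mk0 y hy)).toAdd, by simp⟩
    · intro x; exact Units.ne_zero _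
    · intro g
      simp [ofAdd_sum, map_prod]
  obtain ⟨c, hc⟩ := hsurj ((-1 : F) ^ (ω - 1)) (pow_ne_zero _ (by simp))
  unfold Realizable
  rw [← hc]
  constructor
  · rintro ⟨S, h0, hS, h⟩
    refine ⟨fun i => Finset.univ.filter (fun x => f x ∈ S i), ?_, ?_⟩
    · intro i
      rw [← hS i, ← Finset.card_image_of_injective _ hinj]
      congr 1
      ext y
      simp only [Finset.mem_image, Finset.mem_filter, Finset.mem_univ, true_and]
      constructor
      · rintro ⟨x, hx, rfl⟩; exact hx
      · intro hy
        obtain ⟨x, rfl⟩ := hsurj y (fun h => h0 i (h ▸ hy))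
        exact ⟨x, hy, rfl⟩
    · conv_rhs => rw [← ZMod.card n]
      rw [Finset.card_lt_iff_ne_univ]
      intro hu
      have hm := hu ▸ Finset.mem_univ c
      rw [aux_mem] at hm
      obtain ⟨g, hg, rfl⟩ := hm
      exact h (fun i => f (g i)) (fun i => by simpa using hg i) (hsum g)
  · rintro ⟨T, hT, hlt⟩
    conv_rhs at hlt => rw [← ZMod.card n]
    rw [Finset.card_lt_iff_ne_univ, Ne, Finset.eq_univ_iff_forall] at hlt
    push Not at hlt
    obtain ⟨c', hc'⟩ := hlt
    let s : Fin ω → ZMod n := Pi.single ⟨0, by omega⟩ (c - c')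
    have hs : ∑ i, s i = c - c' := by simp [s]
    refine ⟨fun i => (T i).image (fun x => f (x + s i)), ?_, ?_, ?_⟩
    · intro i hi
      obtain ⟨x, -, hx⟩ := Finset.mem_image.1 hi
      exact hne _ hx
    · intro i
      exact (Finset.card_image_of_injective _ (hinj.comp (add_left_injective (s i)))).trans (hT i)
    · intro a ha heq
      simp only [Finset.mem_image] at ha
      choose g hg hga using ha
      apply hc'
      rw [aux_mem]
      refine ⟨g, hg, ?_⟩
      have : f c = f (∑ i, (g i + s i)) := by rw [hsum, heq]; simp [hga]
      have := hinj this
      rw [Finset.sum_add_distrib, hs] at this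
      linear_combination -this
end

section
/- Let n ≥ 1 and k ≥ 1 be integers and let d_1, …, d_k be positive integers. Then there exist subsets T_1, …, T_k of the additive group ℤ_n of integers modulo n with |T_i| = d_i for each i and |T_1 + T_2 + ⋯ + T_k| < n, if and only if there exists a positive divisor d of n such that n ≥ d · (⌈d_1/d⌉ + ⌈d_2/d⌉ + ⋯ + ⌈d_k/d⌉ − k + 1) + 1 (equivalently, n/d > ⌈d_1/d⌉ + ⋯ + ⌈d_k/d⌉ − k + 1). -/
open Pointwise

namespace KN

variable {G : Type*} [AddCommGroup G] [Fintype G] [DecidableEq G]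

open Classical in
noncomputable def F (H : AddSubgroup G) : Finset G := Finset.univ.filter (· ∈ H)

lemma mem_F {H : AddSubgroup G} {x : G} : x ∈ F H ↔ x ∈ H := by simp [F]

def Per (H : AddSubgroup G) (C : Finset G) : Prop := ∀ h ∈ H, ∀ c ∈ C, h + c ∈ C

lemma F_pos (H : AddSubgroup G) : 0 < (F H).card :=
  Finset.card_pos.2 ⟨0, mem_F.2 H.zero_mem⟩

lemma F_card (H : AddSubgroup G) : (F H).card = Nat.card H := by
  classical
  rw [Nat.card_eq_fintype_card, Fintype.card_subtype]
  unfold F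
  congr

lemma dvd_of_per {H : AddSubgroup G} {C : Finset G} (h : Per H C) : (F H).card ∣ C.card := by
  have h1 := AddSubgroup.card_add_eq_card_addSubgroup_add_card_quotient H (C : Set G)
  have h2 : (C : Set G) + (H : Set G) = C := by
    ext x
    constructor
    · rintro ⟨c, hc, y, hy, rfl⟩
      have := h y hy c hc
      rw [add_comm] at this
      exact this
    · intro hx
      exact ⟨x, hx, 0, H.zero_mem, by simp⟩
  rw [h2] at h1
  rw [F_card]
  have h3 : Nat.card ((C : Set G) : Type _) = C.card := by simp
  rw [h3] at h1
  exact Dvd.intro _ h1.symm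

lemma arith {K m1 m2 p q p' q' X Y : ℕ} (hp : p < m2) (hq : 1 ≤ q) (hq1 : q ≤ m1)
    (hp' : 1 ≤ p') (hp2 : p' ≤ m2) (hq' : q' < m1)
    (h1 : K * ((m2 - p) * q) ≤ X) (h2 : K * (p * (m1 - q)) ≤ Y)
    (h3 : K * ((m2 - p') * q') ≤ X) (h4 : K * (p' * (m1 - q')) ≤ Y) :
    K * m1 ≤ X + K ∨ K * m2 ≤ Y + K := by
  have key : ∀ p q : ℕ, 1 ≤ p → p < m2 → 1 ≤ q → q < m1 → 
      K * ((m2 - p) * q) ≤ X → K * (p * (m1 - q)) ≤ Y → 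
      K * m1 ≤ X + K ∨ K * m2 ≤ Y + K := by
    intro p q a1 a2 a3 a4 a5 a6
    obtain ⟨r, rfl⟩ := Nat.exists_eq_add_of_lt a2
    obtain ⟨s, rfl⟩ := Nat.exists_eq_add_of_lt a4
    have e1 : p + r + 1 - p = r + 1 := by omega
    have e2 : q + s + 1 - q = s + 1 := by omega
    rw [e1] at a5
    rw [e2] at a6
    have : q + s ≤ (r+1) * q ∨ p + r ≤ p * (s+1) := by
      by_contra! hh
      obtain ⟨g1, g2⟩ := hh
      have g1' : r * q < s := by nlinarith
      have g2' : p * s < r := by nlinarith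
      nlinarith
    rcases this with h | h
    · left
      have := Nat.mul_le_mul_left K h
      nlinarith
    · right
      have := Nat.mul_le_mul_left K h
      nlinarith
  by_cases hqm : q = m1
  · left
    have : K * m1 ≤ K * ((m2 - p) * q) := by
      apply Nat.mul_le_mul_left
      rw [hqm]
      exact Nat.le_mul_of_pos_left _ (by omega)
    omega
  by_cases hpm : p' = m2
  · right
    have : K * m2 ≤ K * (p' * (m1 - q')) := by
      apply Nat.mul_le_mul_left
      rw [hpm]
      exact Nat.le_mul_of_pos_right _ (by omega)
    omega
  by_cases hp0 : 1 ≤ p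
  · exact key p q hp0 hp hq (by omega) h1 h2
  by_cases hq0 : 1 ≤ q'
  · exact key p' q' hp' (by omega) hq0 hq' h3 h4
  have hp0 : p = 0 := by omega
  have hq0 : q' = 0 := by omega
  subst hp0 hq0
  have g1 : K * m2 ≤ X := le_trans (Nat.mul_le_mul_left _ (Nat.le_mul_of_pos_right _ hq)) h1
  have g2 : K * m1 ≤ Y := le_trans (Nat.mul_le_mul_left _ (Nat.le_mul_of_pos_left _ hp')) h4
  omega

/-- grid count -/
lemma grid (H1 H2 : AddSubgroup G) (C1 C2 : Finset G) (P1 : Per H1 C1) (P2 : Per H2 C2) (c : G) :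
    ((F H2).filter (fun b => c + b ∉ C1)).card * ((F H1).filter (fun a => c + a ∈ C2)).card
      ≤ (F (H1 ⊓ H2)).card * (C2 \ C1).card := by
  rw [← Finset.card_product]
  refine Finset.card_le_mul_card_image_of_maps_to (f := fun x : G × G => c + x.1 + x.2) ?_ _ ?_
  · rintro ⟨b, a⟩ h
    simp only [Finset.coe_product, Set.mem_prod, Finset.mem_coe, Finset.mem_filter, mem_F,
      Finset.mem_product] at h
    obtain ⟨⟨hb, hb1⟩, ha, ha1⟩ := h
    simp only [Finset.coe_sdiff, Set.mem_diff, Finset.mem_coe, Finset.mem_sdiff]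
    constructor
    · have := P2 b hb _ ha1
      convert this using 1; abel
    · intro hh
      apply hb1
      have := P1 (-a) (H1.neg_mem ha) _ hh
      convert this using 1; abel
  · intro y _
    by_cases hne : (Finset.filter (fun x : G × G => c + x.1 + x.2 = y)
      ({b ∈ F H2 | c + b ∉ C1} ×ˢ {a ∈ F H1 | c + a ∈ C2})).Nonempty
    · obtain ⟨⟨b0, a0⟩, h0⟩ := hne
      simp only [Finset.mem_filter, Finset.mem_product, mem_F] at h0
      refine Finset.card_le_card_of_injOn (fun x => x.2 - a0) ?_ ?_
      · rintro ⟨b, a⟩ h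
        simp only [Finset.mem_coe, Finset.mem_filter, Finset.mem_product, mem_F] at h
        simp only [Finset.mem_coe, mem_F, AddSubgroup.mem_inf]
        refine ⟨H1.sub_mem h.1.2.1 h0.1.2.1, ?_⟩
        have : a - a0 = b0 - b := by
          have e := h.2.trans h0.2.symm
          rw [add_assoc, add_assoc, add_right_inj] at e
          rw [sub_eq_sub_iff_add_eq_add, ← e]; abel
        rw [this]
        exact H2.sub_mem h0.1.1.1 h.1.1.1
      · rintro ⟨b, a⟩ h ⟨b', a'⟩ h' e
        simp only [Finset.mem_coe, Finset.mem_filter, Finset.mem_product, mem_F] at h h'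
        simp only [sub_left_inj] at e
        subst e
        have e := h.2.trans h'.2.symm
        simp only [add_left_inj, add_right_inj] at e
        rw [e]
    · rw [Finset.not_nonempty_iff_eq_empty.1 hne]; simp

lemma union_aux (H1 H2 : AddSubgroup G) (C1 C2 : Finset G) (P1 : Per H1 C1) (P2 : Per H2 C2)
    (n1 : ¬ C2 ⊆ C1) (n2 : ¬ C1 ⊆ C2) :
    (F H1).card ≤ (C2 \ C1).card + (F (H1 ⊓ H2)).card ∨
    (F H2).card ≤ (C1 \ C2).card + (F (H1 ⊓ H2)).card := by
  have hK := F_pos (H1 ⊓ H2)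
  obtain ⟨m1, hm1⟩ : (F (H1 ⊓ H2)).card ∣ (F H1).card := dvd_of_per (by
    intro h hh c hc
    exact mem_F.2 (H1.add_mem hh.1 (mem_F.1 hc)))
  obtain ⟨m2, hm2⟩ : (F (H1 ⊓ H2)).card ∣ (F H2).card := dvd_of_per (by
    intro h hh c hc
    exact mem_F.2 (H2.add_mem hh.2 (mem_F.1 hc)))
  have main : ∀ c : G, ∃ p q, p ≤ m2 ∧ q ≤ m1 ∧
      (F (H1 ⊓ H2)).card * ((m2 - p) * q) ≤ (C2 \ C1).card ∧
      (F (H1 ⊓ H2)).card * (p * (m1 - q)) ≤ (C1 \ C2).card ∧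
      (c ∈ C1 → 1 ≤ p) ∧ (c ∈ C2 → 1 ≤ q) ∧ (c ∉ C1 → p < m2) ∧ (c ∉ C2 → q < m1) := by
    intro c
    obtain ⟨p, hp⟩ : (F (H1 ⊓ H2)).card ∣ ((F H2).filter (fun b => c + b ∈ C1)).card :=
      dvd_of_per (by
        intro h hh b hb
        simp only [Finset.mem_filter, mem_F] at hb ⊢
        refine ⟨H2.add_mem hh.2 hb.1, ?_⟩
        have := P1 h hh.1 _ hb.2
        convert this using 1; abel)
    obtain ⟨q, hq⟩ : (F (H1 ⊓ H2)).card ∣ ((F H1).filter (fun b => c + b ∈ C2)).card :=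
      dvd_of_per (by
        intro h hh b hb
        simp only [Finset.mem_filter, mem_F] at hb ⊢
        refine ⟨H1.add_mem hh.1 hb.1, ?_⟩
        have := P2 h hh.2 _ hb.2
        convert this using 1; abel)
    have s1 := Finset.card_filter_add_card_filter_not (s := F H2) (fun b => c + b ∈ C1)
    have s2 := Finset.card_filter_add_card_filter_not (s := F H1) (fun b => c + b ∈ C2)
    have g1 := grid H1 H2 C1 C2 P1 P2 c
    have g2 := grid H2 H1 C2 C1 P2 P1 c
    rw [inf_comm H2 H1] at g2
    have z1 : c ∈ C1 → 0 < ((F H2).filter (fun b => c + b ∈ C1)).card := fun h =>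
      Finset.card_pos.2 ⟨0, by simp [mem_F, h, H2.zero_mem]⟩
    have z2 : c ∈ C2 → 0 < ((F H1).filter (fun b => c + b ∈ C2)).card := fun h =>
      Finset.card_pos.2 ⟨0, by simp [mem_F, h, H1.zero_mem]⟩
    have z3 : c ∉ C1 → 0 < ((F H2).filter (fun b => c + b ∉ C1)).card := fun h =>
      Finset.card_pos.2 ⟨0, by simp [mem_F, h, H2.zero_mem]⟩
    have z4 : c ∉ C2 → 0 < ((F H1).filter (fun b => c + b ∉ C2)).card := fun h =>
      Finset.card_pos.2 ⟨0, by simp [mem_F, h, H1.zero_mem]⟩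
    generalize ((F H2).filter (fun b => c + b ∈ C1)).card = U1 at *
    generalize ((F H2).filter (fun b => c + b ∉ C1)).card = V1 at *
    generalize ((F H1).filter (fun b => c + b ∈ C2)).card = U2 at *
    generalize ((F H1).filter (fun b => c + b ∉ C2)).card = V2 at *
    rw [hm2] at s1
    rw [hm1] at s2
    generalize (F (H1 ⊓ H2)).card = K at *
    subst hp hq
    have e1 : V1 = K * (m2 - p) := by rw [Nat.mul_sub]; omega
    have e2 : V2 = K * (m1 - q) := by rw [Nat.mul_sub]; omega
    have l1 : p ≤ m2 := Nat.le_of_mul_le_mul_left (by omega : K * p ≤ K * m2) hK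
    have l2 : q ≤ m1 := Nat.le_of_mul_le_mul_left (by omega : K * q ≤ K * m1) hK
    subst e1 e2
    refine ⟨p, q, l1, l2, ?_, ?_, ?_, ?_, ?_, ?_⟩
    · apply Nat.le_of_mul_le_mul_left _ hK
      calc _ = _ := by ring
        _ ≤ _ := g1
    · apply Nat.le_of_mul_le_mul_left _ hK
      calc _ = _ := by ring
        _ ≤ _ := g2
    · intro h; exact Nat.pos_of_mul_pos_left (z1 h)
    · intro h; exact Nat.pos_of_mul_pos_left (z2 h)
    · intro h; have := Nat.pos_of_mul_pos_left (z3 h); omega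
    · intro h; have := Nat.pos_of_mul_pos_left (z4 h); omega
  obtain ⟨c, hc2, hc1⟩ := Finset.not_subset.1 n1
  obtain ⟨c', hc1', hc2'⟩ := Finset.not_subset.1 n2
  obtain ⟨p, q, a1, a2, a3, a4, a5, a6, a7, a8⟩ := main c
  obtain ⟨p', q', b1, b2, b3, b4, b5, b6, b7, b8⟩ := main c'
  rw [hm1, hm2]
  exact arith (a7 hc1) (a6 hc2) a2 (b5 hc1') b1 (b8 hc2') a3 a4 b3 b4

def Good (N : ℕ) (C : Finset G) : Prop := ∃ H : AddSubgroup G, Per H C ∧ N ≤ C.card + (F H).card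

lemma good_union {N : ℕ} {C1 C2 : Finset G} (g1 : Good N C1) (g2 : Good N C2) :
    Good N (C1 ∪ C2) := by
  by_cases n1 : C2 ⊆ C1
  · rwa [Finset.union_eq_left.2 n1]
  by_cases n2 : C1 ⊆ C2
  · rwa [Finset.union_eq_right.2 n2]
  obtain ⟨H1, P1, N1⟩ := g1
  obtain ⟨H2, P2, N2⟩ := g2
  refine ⟨H1 ⊓ H2, ?_, ?_⟩
  · intro h hh c hc
    rcases Finset.mem_union.1 hc with hc | hc
    · exact Finset.mem_union_left _ (P1 h hh.1 c hc)
    · exact Finset.mem_union_right _ (P2 h hh.2 c hc)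
  · have e1 : (C1 ∪ C2).card = C1.card + (C2 \ C1).card := by
      rw [← Finset.union_sdiff_self_eq_union, Finset.card_union_of_disjoint Finset.disjoint_sdiff]
    have e2 : (C1 ∪ C2).card = C2.card + (C1 \ C2).card := by
      rw [Finset.union_comm, ← Finset.union_sdiff_self_eq_union,
        Finset.card_union_of_disjoint Finset.disjoint_sdiff]
    rcases union_aux H1 H2 C1 C2 P1 P2 n1 n2 with h | h <;> omega

lemma dyson (m : ℕ) : ∀ A B : Finset G, B.card ≤ m → 0 ∈ A → 0 ∈ B →
    ∃ C, C ⊆ A + B ∧ 0 ∈ C ∧ Good (A.card + B.card) C := by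
  induction m with
  | zero =>
    intro A B h _ hB
    have := Finset.card_pos.2 ⟨0, hB⟩
    omega
  | succ m ih =>
    intro A B hm hA hB
    by_cases hall : ∀ e ∈ A, ∀ b ∈ B, b + e ∈ A
    · refine ⟨A, ?_, hA, AddSubgroup.closure (B : Set G), ?_, ?_⟩
      · intro a ha
        exact Finset.mem_add.2 ⟨a, ha, 0, hB, add_zero a⟩
      · intro h hh
        induction hh using AddSubgroup.closure_induction with
        | mem x hx => exact fun c hc => hall c hc x hx
        | zero => simp
        | add x y _ _ hx hy => intro c hc; rw [add_assoc]; exact hx _ (hy _ hc)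
        | neg x _ hx =>
          intro c hc
          have hinj : Set.InjOn (fun c => x + c) (A : Set G) := fun a _ b _ h => add_left_cancel h
          obtain ⟨d, hd, hdc⟩ := Finset.surjOn_of_injOn_of_card_le (s := A) (t := A)
            (fun c => x + c) (fun c hc => hx c hc) hinj le_rfl hc
          simp only at hdc
          rw [← hdc, neg_add_cancel_left]; exact hd
      · apply Nat.add_le_add_left
        apply Finset.card_le_card
        intro b hb
        exact mem_F.2 (AddSubgroup.subset_closure hb)
    · push Not at hall
      obtain ⟨e, he, b, hb, hbe⟩ := hall
      have hlt : (B.filter (fun x => x + e ∈ A)).card < B.card :=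
        Finset.card_lt_card (Finset.filter_ssubset.2 ⟨b, hb, hbe⟩)
      obtain ⟨C, hC, hC0, hg⟩ := ih (A ∪ B.image (· + e)) (B.filter (fun x => x + e ∈ A))
        (by omega) (Finset.mem_union_left _ hA) (by simp [hB, he])
      refine ⟨C, hC.trans ?_, hC0, ?_⟩
      · intro x hx
        obtain ⟨y, hy, z, hz, rfl⟩ := Finset.mem_add.1 hx
        rw [Finset.mem_filter] at hz
        rcases Finset.mem_union.1 hy with hy | hy
        · exact Finset.add_mem_add hy hz.1
        · obtain ⟨w, hw, rfl⟩ := Finset.mem_image.1 hy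
          have : w + e + z = (z + e) + w := by abel
          rw [this]
          exact Finset.add_mem_add hz.2 hw
      · convert hg using 1
        have h1 : (A ∪ B.image (· + e)).card + (A ∩ B.image (· + e)).card
            = A.card + (B.image (· + e)).card := Finset.card_union_add_card_inter _ _
        have h2 : (B.image (· + e)).card = B.card :=
          Finset.card_image_of_injective _ (add_left_injective e)
        have h3 : (A ∩ B.image (· + e)) = (B.filter (fun x => x + e ∈ A)).image (· + e) := by
          ext x
          simp only [Finset.mem_inter, Finset.mem_image, Finset.mem_filter]
          constructor
          · rintro ⟨hx, w, hw, rfl⟩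
            exact ⟨w, ⟨hw, hx⟩, rfl⟩
          · rintro ⟨w, ⟨hw, hx⟩, rfl⟩
            exact ⟨hx, w, hw, rfl⟩
        rw [h3, Finset.card_image_of_injective _ (add_left_injective e)] at h1
        omega

lemma good_point (A B : Finset G) (x : G) (hx : x ∈ A + B) :
    ∃ C, C ⊆ A + B ∧ x ∈ C ∧ Good (A.card + B.card) C := by
  obtain ⟨a, ha, b, hb, rfl⟩ := Finset.mem_add.1 hx
  obtain ⟨C, hC, hC0, H, hP, hN⟩ := dyson _ (A.image (· + -a)) (B.image (· + -b)) le_rfl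
    (Finset.mem_image.2 ⟨a, ha, by simp⟩) (Finset.mem_image.2 ⟨b, hb, by simp⟩)
  refine ⟨C.image (· + (a + b)), ?_, ?_, H, ?_, ?_⟩
  · intro y hy
    obtain ⟨c, hc, rfl⟩ := Finset.mem_image.1 hy
    obtain ⟨u, hu, v, hv, rfl⟩ := Finset.mem_add.1 (hC hc)
    obtain ⟨u, hu', rfl⟩ := Finset.mem_image.1 hu
    obtain ⟨v, hv', rfl⟩ := Finset.mem_image.1 hv
    have : u + -a + (v + -b) + (a + b) = u + v := by abel
    simp only [this]
    exact Finset.add_mem_add hu' hv'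
  · exact Finset.mem_image.2 ⟨0, hC0, by simp⟩
  · intro h hh y hy
    obtain ⟨c, hc, rfl⟩ := Finset.mem_image.1 hy
    exact Finset.mem_image.2 ⟨h + c, hP h hh c hc, by abel⟩
  · rw [Finset.card_image_of_injective _ (add_left_injective _)] at hN ⊢
    rw [Finset.card_image_of_injective _ (add_left_injective _)] at hN
    exact hN

lemma kneser (A B : Finset G) (hA : A.Nonempty) (hB : B.Nonempty) :
    Good (A.card + B.card) (A + B) := by
  have key : ∀ s : Finset G, s.Nonempty → s ⊆ A + B →
      ∃ C, C ⊆ A + B ∧ s ⊆ C ∧ Good (A.card + B.card) C := by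
    intro s hs
    induction hs using Finset.Nonempty.cons_induction with
    | singleton a =>
      intro h
      obtain ⟨C, h1, h2, h3⟩ := good_point A B a (by simpa using h)
      exact ⟨C, h1, by simpa using h2, h3⟩
    | cons a s ha hs ih =>
      intro h
      rw [Finset.cons_eq_insert, Finset.insert_subset_iff] at h
      obtain ⟨C, h1, h2, h3⟩ := good_point A B a h.1
      obtain ⟨C', h1', h2', h3'⟩ := ih h.2
      refine ⟨C ∪ C', Finset.union_subset h1 h1', ?_, good_union h3 h3'⟩
      rw [Finset.cons_eq_insert, Finset.insert_subset_iff]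
      exact ⟨Finset.mem_union_left _ h2, h2'.trans Finset.subset_union_right⟩
  obtain ⟨C, h1, h2, h3⟩ := key (A + B) (hA.add hB) subset_rfl
  rwa [Finset.Subset.antisymm h1 h2] at h3

lemma kneser_multi {ι : Type*} [DecidableEq ι] (T : ι → Finset G) (hT : ∀ i, (T i).Nonempty)
    (H : AddSubgroup G) (s : Finset ι) :
    (∀ H' : AddSubgroup G, Per H' ((∑ i ∈ s, T i) + F H) → H' ≤ H) →
    (∑ i ∈ s, (T i + F H).card) + (F H).card ≤
      ((∑ i ∈ s, T i) + F H).card + s.card * (F H).card := by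
  have hne : (F H).Nonempty := ⟨0, mem_F.2 H.zero_mem⟩
  have hFF : F H + F H = F H := by
    ext x
    constructor
    · intro hx
      obtain ⟨a, ha, b, hb, rfl⟩ := Finset.mem_add.1 hx
      exact mem_F.2 (H.add_mem (mem_F.1 ha) (mem_F.1 hb))
    · intro hx
      exact Finset.mem_add.2 ⟨x, hx, 0, mem_F.2 H.zero_mem, add_zero x⟩
  induction s using Finset.induction_on with
  | empty => intro _; simp
  | insert j s hj ih =>
    intro hmax
    rw [Finset.sum_insert hj] at hmax ⊢
    rw [Finset.sum_insert hj, Finset.card_insert_of_notMem hj]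
    have hX : T j + ∑ i ∈ s, T i + F H = (∑ i ∈ s, T i + F H) + (T j + F H) := by
      rw [add_add_add_comm, hFF, add_comm (T j)]
    rw [hX] at hmax ⊢
    have hsne : (∑ i ∈ s, T i).Nonempty := by
      clear ih hmax hX hj
      induction s using Finset.induction_on with
      | empty => simp
      | insert j s hj ih => rw [Finset.sum_insert hj]; exact (hT j).add ih
    have := ih (by
      intro H' hP
      apply hmax
      intro h hh c hc
      obtain ⟨a, ha, b, hb, rfl⟩ := Finset.mem_add.1 hc
      rw [← add_assoc h a b]
      exact Finset.add_mem_add (hP h hh a ha) hb)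
    obtain ⟨H', hP, hN⟩ := kneser _ _ (hsne.add hne) ((hT j).add hne)
    have hle : (F H').card ≤ (F H).card :=
      Finset.card_le_card fun x hx => mem_F.2 (hmax H' hP (mem_F.1 hx))
    rw [add_mul, one_mul]
    omega

/-- stabilizer -/
def stab (C : Finset G) : AddSubgroup G where
  carrier := {h | ∀ c, h + c ∈ C ↔ c ∈ C}
  zero_mem' := by simp
  add_mem' := by
    intro a b ha hb c
    rw [add_assoc, ha, hb]
  neg_mem' := by
    intro a ha c
    rw [← ha, add_neg_cancel_left]

lemma per_stab (C : Finset G) : Per (stab C) C := fun h hh c hc => (hh c).2 hc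

lemma le_stab {C : Finset G} {H : AddSubgroup G} (hP : Per H C) : H ≤ stab C := by
  intro h hh c
  refine ⟨fun hc => ?_, hP h hh c⟩
  have := hP (-h) (H.neg_mem hh) _ hc
  rwa [neg_add_cancel_left] at this

lemma forward {k : ℕ} (T : Fin k → Finset G) (hT : ∀ i, (T i).Nonempty) :
    ∃ e : ℕ, e ∣ Fintype.card G ∧ 0 < e ∧ ∃ c : Fin k → ℕ, (∀ i, (T i).card ≤ e * c i) ∧
      e * (∑ i, c i) + e ≤ (∑ i, T i).card + k * e := by
  set S := ∑ i, T i with hS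
  set H := stab S
  have hSF : S + F H = S := by
    ext x
    constructor
    · intro hx
      obtain ⟨a, ha, b, hb, rfl⟩ := Finset.mem_add.1 hx
      rw [add_comm]
      exact per_stab S b (mem_F.1 hb) a ha
    · intro hx
      exact Finset.mem_add.2 ⟨x, hx, 0, mem_F.2 H.zero_mem, add_zero x⟩
  have main := kneser_multi T hT H Finset.univ (by
    rw [← hS, hSF]; exact fun H' hP => le_stab hP)
  rw [← hS, hSF] at main
  have hd : ∀ i, (F H).card ∣ (T i + F H).card := fun i => dvd_of_per (by
    intro h hh c hc
    obtain ⟨a, ha, b, hb, rfl⟩ := Finset.mem_add.1 hc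
    rw [add_left_comm]
    exact Finset.add_mem_add ha (mem_F.2 (H.add_mem hh (mem_F.1 hb))))
  choose c hc using hd
  refine ⟨(F H).card, ?_, F_pos H, c, ?_, ?_⟩
  · rw [← Finset.card_univ]
    exact dvd_of_per (fun _ _ _ _ => Finset.mem_univ _)
  · intro i
    rw [← hc]
    apply Finset.card_le_card
    intro x hx
    exact Finset.mem_add.2 ⟨x, hx, 0, mem_F.2 H.zero_mem, add_zero x⟩
  · simp only [hc, ← Finset.mul_sum, Finset.card_univ, Fintype.card_fin] at main
    exact main

lemma block_card (n e m c : ℕ) [NeZero n] (hn : n = e * m) (hc : c ≤ m) :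
    e * c ≤ (Finset.univ.filter (fun x : ZMod n => x.val % m < c)).card := by
  have h := Finset.card_le_card_of_injOn (s := Finset.range e ×ˢ Finset.range c)
    (t := Finset.univ.filter (fun x : ZMod n => x.val % m < c))
    (fun x => ((m * x.1 + x.2 : ℕ) : ZMod n)) ?_ ?_
  · simpa using h
  · rintro ⟨q, r⟩ hx
    simp only [Finset.coe_product, Set.mem_prod, Finset.mem_coe, Finset.mem_range,
      Finset.mem_product] at hx
    simp only [Finset.mem_coe, Finset.mem_filter, Finset.mem_univ, true_and, ZMod.val_natCast]
    rw [Nat.mod_mod_of_dvd _ (Dvd.intro_left e hn.symm), Nat.mul_add_mod,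
      Nat.mod_eq_of_lt (by omega)]
    exact hx.2
  · have hlt : ∀ q r, q < e → r < c → m * q + r < n := by
      intro q r hq hr
      rw [hn]
      nlinarith
    rintro ⟨q, r⟩ hx ⟨q', r'⟩ hx' he
    simp only [Finset.coe_product, Set.mem_prod, Finset.mem_coe, Finset.mem_range,
      Finset.mem_product] at hx hx'
    have he := congrArg ZMod.val he
    simp only [ZMod.val_natCast] at he
    rw [Nat.mod_eq_of_lt (hlt _ _ hx.1 hx.2), Nat.mod_eq_of_lt (hlt _ _ hx'.1 hx'.2)] at he
    have h1 := congrArg (· % m) he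
    simp only [Nat.mul_add_mod] at h1
    rw [Nat.mod_eq_of_lt (by omega), Nat.mod_eq_of_lt (by omega)] at h1
    subst h1
    have h2 : m * q = m * q' := by omega
    have h3 : q = q' := Nat.eq_of_mul_eq_mul_left (by omega) h2
    rw [h3]

lemma sum_block {ι : Type*} [DecidableEq ι] (n m : ℕ) [NeZero n] (hm : m ∣ n)
    (T : ι → Finset (ZMod n)) (c : ι → ℕ) (hT : ∀ i, ∀ x ∈ T i, x.val % m ≤ c i) (s : Finset ι) :
    ∀ x ∈ ∑ i ∈ s, T i, x.val % m ≤ ∑ i ∈ s, c i := by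
  induction s using Finset.induction_on with
  | empty => intro x hx; simp at hx; simp [hx]
  | insert j s hj ih =>
    intro x hx
    rw [Finset.sum_insert hj] at hx ⊢
    obtain ⟨a, ha, b, hb, rfl⟩ := Finset.mem_add.1 hx
    rw [ZMod.val_add, Nat.mod_mod_of_dvd _ hm, Nat.add_mod]
    exact (Nat.mod_le _ _).trans (Nat.add_le_add (hT j a ha) (ih b hb))

lemma backward {k : ℕ} (n e m : ℕ) [NeZero n] (hn : n = e * m) (d c : Fin k → ℕ)
    (hd : ∀ i, d i ≤ e * (c i + 1)) (hm : ∑ i, c i + 1 < m) :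
    ∃ T : Fin k → Finset (ZMod n), (∀ i, (T i).card = d i) ∧ (∑ i, T i).card < n := by
  have : ∀ i, ∃ t ⊆ (Finset.univ.filter (fun x : ZMod n => x.val % m < c i + 1)),
      t.card = d i := by
    intro i
    apply Finset.exists_subset_card_eq
    refine (hd i).trans (block_card n e m _ hn ?_)
    have := Finset.single_le_sum (f := c) (fun i _ => Nat.zero_le _) (Finset.mem_univ i)
    omega
  choose T hT hc using this
  refine ⟨T, hc, ?_⟩
  have hb := sum_block n m (Dvd.intro_left e hn.symm) T c (by
    intro i x hx
    have := (Finset.mem_filter.1 (hT i hx)).2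
    omega) Finset.univ
  have hlt : ((m - 1 : ℕ) : ZMod n) ∉ ∑ i, T i := by
    intro h
    have := hb _ h
    rw [ZMod.val_natCast, Nat.mod_mod_of_dvd _ (Dvd.intro_left e hn.symm),
      Nat.mod_eq_of_lt (by omega)] at this
    omega
  have := Finset.card_lt_card (Finset.ssubset_univ_iff.2
    (fun h => hlt (h ▸ Finset.mem_univ _) : (∑ i, T i) ≠ Finset.univ))
  simpa [ZMod.card] using this

end KN

theorem sumset_not_exhaust_iff_divisor
    (n k : ℕ) (hn : 1 ≤ n) (hk : 1 ≤ k) (d : Fin k → ℕ) (hd : ∀ i, 0 < d i) :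
    (∃ T : Fin k → Finset (ZMod n),
        (∀ i, (T i).card = d i) ∧ (∑ i, T i).card < n) ↔
      ∃ e ∈ n.divisors,
        (n : ℤ) ≥ (e : ℤ) * (∑ i, ⌈((d i : ℚ)) / (e : ℚ)⌉ - (k : ℤ) + 1) + 1 := by
  haveI : NeZero n := ⟨by omega⟩
  constructor
  · rintro ⟨T, hT, hlt⟩
    obtain ⟨e, he, he0, c, hc, hmain⟩ := KN.forward T (fun i => Finset.card_pos.1 (by
      rw [hT]; exact hd i))
    rw [ZMod.card] at he
    refine ⟨e, Nat.mem_divisors.2 ⟨he, by omega⟩, ?_⟩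
    have h1 : ∑ i, ⌈((d i : ℚ)) / (e : ℚ)⌉ ≤ ∑ i, (c i : ℤ) := by
      apply Finset.sum_le_sum
      intro i _
      rw [Int.ceil_le, div_le_iff₀ (by exact_mod_cast he0)]
      have := hc i
      rw [hT, mul_comm] at this
      exact_mod_cast this
    have h2 : ((e : ℤ) * (∑ i, (c i : ℤ)) + e) + 1 ≤ n + k * e := by
      have : e * (∑ i, c i) + e + 1 ≤ n + k * e := by omega
      exact_mod_cast this
    have h3 := mul_le_mul_of_nonneg_left h1 (Int.natCast_nonneg e)
    nlinarith
  · rintro ⟨e, he, h⟩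
    obtain ⟨⟨m, hm⟩, _⟩ := Nat.mem_divisors.1 he
    have he0 : 0 < e := Nat.pos_of_mem_divisors he
    have he0' : (0 : ℚ) < e := by exact_mod_cast he0
    have hpos : ∀ i, 0 < ⌈((d i : ℚ)) / (e : ℚ)⌉ := fun i =>
      Int.ceil_pos.2 (div_pos (by exact_mod_cast hd i) he0')
    have hcc : ∀ i, ((⌈((d i : ℚ)) / (e : ℚ)⌉ - 1).toNat : ℤ) = ⌈((d i : ℚ)) / (e : ℚ)⌉ - 1 :=
      fun i => Int.toNat_of_nonneg (by have := hpos i; omega)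
    refine KN.backward n e m hm d (fun i => (⌈((d i : ℚ)) / (e : ℚ)⌉ - 1).toNat) ?_ ?_
    · intro i
      have h1 := Int.le_ceil ((d i : ℚ) / (e : ℚ))
      rw [div_le_iff₀ he0'] at h1
      have h2 : (d i : ℤ) ≤ ⌈((d i : ℚ)) / (e : ℚ)⌉ * e := by exact_mod_cast h1
      zify
      rw [hcc]
      linarith
    · zify
      simp only [hcc, Finset.sum_sub_distrib, Finset.sum_const, Finset.card_univ,
        Fintype.card_fin, smul_eq_mul, nsmul_eq_mul, mul_one]
      rw [hm] at h
      push_cast at h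
      have : (e : ℤ) * (∑ i, ⌈((d i : ℚ)) / (e : ℚ)⌉ - (k : ℤ) + 1) < e * m := by linarith
      exact lt_of_mul_lt_mul_left this (by positivity)
end

section
/- Let F be a finite field of order q, let ω ≥ 3 be an integer, and let d_1, …, d_ω be integers each at least 2. Then the tuple (d_1, …, d_ω) is realizable over F if and only if there exists a positive divisor d of q − 1 such that q ≥ d · (⌈d_1/d⌉ + ⌈d_2/d⌉ + ⋯ + ⌈d_ω/d⌉ − ω + 1) + 2 (equivalently, (q−1)/d > ⌈d_1/d⌉ + ⋯ + ⌈d_ω/d⌉ − ω + 1). -/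
open Pointwise

set_option linter.unusedSectionVars false

namespace KN
variable {G : Type*} [CommGroup G] [Finite G]

def Inv (H : Subgroup G) (C : Set G) : Prop := ∀ h ∈ H, ∀ x ∈ C, h * x ∈ C

lemma Inv.iff {H : Subgroup G} {C : Set G} (hC : Inv H C) {h x : G} (hh : h ∈ H) :
    h * x ∈ C ↔ x ∈ C := by
  constructor
  · intro hx
    have := hC h⁻¹ (H.inv_mem hh) _ hx
    simpa using this
  · exact hC h hh x

lemma ncard_coset (H : Subgroup G) (x : G) : (x • (H : Set G)).ncard = Nat.card H := by
  rw [Set.ncard_smul_set]; rfl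

lemma cross {C1 C2 : Set G} {H1 H2 : Subgroup G} (h1 : Inv H1 C1) (h2 : Inv H2 C2) {x : G}
    (hx2 : x ∈ C2) (hx1 : x ∉ C1) :
    (C2 ∩ x • (H1 : Set G)).ncard + (x • (H2 : Set G) \ C1).ncard ≤
      (C2 \ C1).ncard + Nat.card (H1 ⊓ H2 : Subgroup G) := by
  rw [← Set.ncard_union_add_ncard_inter]
  apply Nat.add_le_add
  · apply Set.ncard_le_ncard _ (Set.toFinite _)
    rintro y (⟨hy, hyx⟩ | ⟨hyx, hy⟩)
    · refine ⟨hy, fun hy1 => hx1 ?_⟩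
      rw [mem_leftCoset_iff] at hyx
      have := h1 _ (H1.inv_mem hyx) _ hy1
      simpa [mul_comm] using this
    · refine ⟨?_, hy⟩
      rw [mem_leftCoset_iff] at hyx
      have := h2 _ hyx _ hx2
      simpa [mul_comm] using this
  · rw [← ncard_coset _ x]
    apply Set.ncard_le_ncard _ (Set.toFinite _)
    rintro y ⟨⟨hy, hyx⟩, ⟨hyx', hy'⟩⟩
    rw [mem_leftCoset_iff] at *
    exact ⟨hyx, hyx'⟩

lemma shift {C : Set G} {H K : Subgroup G} (hC : Inv K C) {x y : G}
    (hxy : ∃ h ∈ H, ∃ k ∈ K, y = h * k * x) :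
    (C ∩ x • (H : Set G)).ncard + (y • (H : Set G) \ C).ncard = Nat.card H := by
  obtain ⟨h, hh, k, hk, rfl⟩ := hxy
  have : (h * k * x) • (H : Set G) \ C = k • (x • (H : Set G) \ C) := by
    ext z
    rw [Set.mem_smul_set_iff_inv_smul_mem]
    simp only [Set.mem_sdiff, mem_leftCoset_iff, smul_eq_mul, SetLike.mem_coe]
    rw [hC.iff (K.inv_mem hk)]
    apply and_congr_left
    intro _
    have e : (h * k * x)⁻¹ * z = h⁻¹ * (x⁻¹ * (k⁻¹ * z)) := by
      simp only [mul_inv]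
      rw [mul_comm h⁻¹ k⁻¹, mul_assoc, mul_assoc, mul_comm k⁻¹, mul_assoc, mul_assoc,
        mul_comm z]
    rw [e, H.mul_mem_cancel_left (H.inv_mem hh)]
  rw [this, Set.ncard_smul_set, Set.inter_comm, Set.ncard_inter_add_ncard_sdiff_eq_ncard _ _ (Set.toFinite _), ncard_coset]

/-- no element of `C1 \ C2` in the double coset of `x` -/
lemma oneside {C1 C2 : Set G} {H1 H2 : Subgroup G} (h1 : Inv H1 C1) (h2 : Inv H2 C2) {x : G}
    (hx2 : x ∈ C2) (hx1 : x ∉ C1)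
    (hno : ∀ h ∈ H1, ∀ k ∈ H2, h * k * x ∈ C1 → h * k * x ∈ C2) :
    Nat.card H1 ≤ (C2 \ C1).ncard ∨ Nat.card H2 ≤ (C2 \ C1).ncard := by
  by_cases hD : ∃ h ∈ H1, ∃ k ∈ H2, h * k * x ∈ C1
  · left
    obtain ⟨h, hh, k, hk, hc⟩ := hD
    rw [← ncard_coset H1 x]
    apply Set.ncard_le_ncard _ (Set.toFinite _)
    intro y hy
    rw [mem_leftCoset_iff] at hy
    constructor
    · have e : y = x⁻¹ * y * x := by rw [mul_comm, mul_inv_cancel_left]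
      have h3 : k * x ∈ C1 := by
        rw [mul_assoc] at hc; exact (h1.iff hh).1 hc
      have h4 := h1 _ hy _ h3
      rw [← mul_assoc] at h4
      have h5 := hno _ hy _ hk h4
      rw [mul_comm (x⁻¹ * y), mul_assoc] at h5
      rw [e]; exact (h2.iff hk).1 h5
    · intro hy1
      have := h1 _ (H1.inv_mem hy) _ hy1
      exact hx1 (by simpa [mul_comm] using this)
  · right
    push Not at hD
    rw [← ncard_coset H2 x]
    apply Set.ncard_le_ncard _ (Set.toFinite _)
    intro y hy
    rw [mem_leftCoset_iff] at hy
    have e : x⁻¹ * y * x = y := by rw [mul_comm, mul_inv_cancel_left]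
    constructor
    · rw [← e]; exact h2 _ hy _ hx2
    · have := hD 1 H1.one_mem _ hy
      rwa [one_mul, e] at this

def P (m : ℕ) (C : Set G) : Prop := ∃ H : Subgroup G, Inv H C ∧ m ≤ C.ncard + Nat.card H

lemma P.union {m : ℕ} {C1 C2 : Set G} (p1 : P m C1) (p2 : P m C2) : P m (C1 ∪ C2) := by
  by_cases s1 : C1 ⊆ C2
  · rwa [Set.union_eq_right.2 s1]
  by_cases s2 : C2 ⊆ C1
  · rwa [Set.union_eq_left.2 s2]
  obtain ⟨y, hy1, hy2⟩ := Set.not_subset.1 s1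
  obtain ⟨x, hx2, hx1⟩ := Set.not_subset.1 s2
  obtain ⟨H1, h1, c1⟩ := p1
  obtain ⟨H2, h2, c2⟩ := p2
  refine ⟨H1 ⊓ H2, ?_, ?_⟩
  · rintro h ⟨ha, hb⟩ x (hx | hx)
    · exact Or.inl (h1 h ha x hx)
    · exact Or.inr (h2 h hb x hx)
  have u1 : (C1 ∪ C2).ncard = C1.ncard + (C2 \ C1).ncard := by
    rw [add_comm, Set.ncard_sdiff_add_ncard, Set.union_comm]
  have u2 : (C1 ∪ C2).ncard = C2.ncard + (C1 \ C2).ncard := by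
    rw [add_comm, Set.ncard_sdiff_add_ncard]
  suffices Nat.card H1 ≤ (C2 \ C1).ncard + Nat.card (H1 ⊓ H2 : Subgroup G) ∨
    Nat.card H2 ≤ (C1 \ C2).ncard + Nat.card (H1 ⊓ H2 : Subgroup G) by omega
  have main : ∀ x y, x ∈ C2 → x ∉ C1 → y ∈ C1 → y ∉ C2 →
      (∃ h ∈ H1, ∃ k ∈ H2, y = h * k * x) →
      Nat.card H1 ≤ (C2 \ C1).ncard + Nat.card (H1 ⊓ H2 : Subgroup G) ∨
    Nat.card H2 ≤ (C1 \ C2).ncard + Nat.card (H1 ⊓ H2 : Subgroup G) := by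
    intro x y hx2 hx1 hy1 hy2 hxy
    have q1 := cross h1 h2 hx2 hx1
    have q2 := cross h2 h1 hy1 hy2
    have q3 := shift h2 hxy
    have q4 : (C1 ∩ y • (H2 : Set G)).ncard + (x • (H2 : Set G) \ C1).ncard = Nat.card H2 := by
      apply shift h1
      obtain ⟨h, hh, k, hk, rfl⟩ := hxy
      refine ⟨k⁻¹, H2.inv_mem hk, h⁻¹, H1.inv_mem hh, ?_⟩
      rw [← mul_inv, mul_comm k h, inv_mul_cancel_left]
    rw [inf_comm H2 H1] at q2
    omega
  by_cases n1 : ∀ h ∈ H1, ∀ k ∈ H2, h * k * x ∈ C1 → h * k * x ∈ C2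
  · by_cases n2 : ∀ h ∈ H2, ∀ k ∈ H1, h * k * y ∈ C2 → h * k * y ∈ C1
    · have := oneside h1 h2 hx2 hx1 n1
      have := oneside h2 h1 hy1 hy2 n2
      omega
    · push Not at n2
      obtain ⟨h, hh, k, hk, q, q'⟩ := n2
      refine main _ _ q q' hy1 hy2 ⟨k⁻¹, H1.inv_mem hk, h⁻¹, H2.inv_mem hh, ?_⟩
      rw [← mul_inv, mul_comm k h, inv_mul_cancel_left]
  · push Not at n1
    obtain ⟨h, hh, k, hk, q, q'⟩ := n1
    exact main _ _ hx2 hx1 q q' ⟨h, hh, k, hk, rfl⟩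

lemma dyson_s5 (n : ℕ) : ∀ (A B : Set G), B.ncard = n → ∀ a ∈ A, ∀ b ∈ B,
    ∃ C ⊆ A * B, a * b ∈ C ∧ P (A.ncard + B.ncard) C := by
  induction n using Nat.strong_induction_on with
  | _ n ih =>
  intro A B hn a ha b hb
  by_cases hall : ∀ e ∈ A, ∀ x ∈ B, e * (b⁻¹ * x) ∈ A
  · -- B b⁻¹ stabilises A
    refine ⟨b • A, ?_, ?_, ?_⟩
    · rintro _ ⟨y, hy, rfl⟩
      exact ⟨y, hy, b, hb, mul_comm _ _⟩
    · exact ⟨a, ha, mul_comm _ _⟩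
    · refine ⟨MulAction.stabilizer G A, ?_, ?_⟩
      · intro h hh x hx
        rw [MulAction.mem_stabilizer_iff] at hh
        rw [Set.mem_smul_set_iff_inv_smul_mem] at *
        have : h • (b⁻¹ • x) ∈ h • A := Set.smul_mem_smul_set hx
        rw [hh] at this
        simpa [mul_left_comm] using this
      · rw [Set.ncard_smul_set]
        apply Nat.add_le_add_left
        rw [← Set.ncard_smul_set b⁻¹ B]
        change _ ≤ ((MulAction.stabilizer G A : Subgroup G) : Set G).ncard
        apply Set.ncard_le_ncard _ (Set.toFinite _)
        rintro _ ⟨x, hx, rfl⟩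
        change _ • A = A
        apply Set.eq_of_subset_of_ncard_le _ _ (Set.toFinite _)
        · rintro _ ⟨e, he, rfl⟩
          have := hall e he x hx
          simpa [mul_comm] using this
        · rw [Set.ncard_smul_set]
  · push Not at hall
    obtain ⟨e, he, x, hx, hex⟩ := hall
    -- translate
    set A' := A ∪ (e * b⁻¹) • B with hA'
    set B' := B ∩ (e * b⁻¹)⁻¹ • A with hB'
    have hlt : B'.ncard < n := by
      rw [← hn]
      apply Set.ncard_lt_ncard _ (Set.toFinite _)
      refine ⟨Set.inter_subset_left, fun h => hex ?_⟩
      have := (h hx).2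
      rw [Set.mem_smul_set_iff_inv_smul_mem] at this
      simpa [mul_assoc] using this
    have hb' : b ∈ B' := by
      refine ⟨hb, ?_⟩
      rw [Set.mem_smul_set_iff_inv_smul_mem]
      simpa using he
    obtain ⟨C, hC, hab, hP⟩ := ih _ hlt A' B' rfl a (Or.inl ha) b hb'
    refine ⟨C, hC.trans ?_, hab, ?_⟩
    · rintro _ ⟨u, (hu | hu), v, ⟨hv, hv'⟩, rfl⟩
      · exact ⟨u, hu, v, hv, rfl⟩
      · obtain ⟨w, hw, rfl⟩ := hu
        obtain ⟨z, hz, rfl⟩ := hv'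
        refine ⟨z, hz, w, hw, ?_⟩
        simp only [smul_eq_mul]
        rw [mul_mul_mul_comm, mul_inv_cancel, one_mul, mul_comm]
    · have : A'.ncard + B'.ncard = A.ncard + B.ncard := by
        have : B' = (e * b⁻¹)⁻¹ • (A ∩ (e * b⁻¹) • B) := by
          rw [Set.smul_set_inter, inv_smul_smul, Set.inter_comm]
        rw [this, Set.ncard_smul_set, Set.ncard_union_add_ncard_inter, Set.ncard_smul_set]
      rwa [← this]

lemma kneser_s5 {A B : Set G} (hA : A.Nonempty) (hB : B.Nonempty) :
    P (A.ncard + B.ncard) (A * B) := by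
  obtain ⟨a0, ha0⟩ := hA
  obtain ⟨b0, hb0⟩ := hB
  -- largest good subset
  have key : ∀ T : Set G, T.Finite → T ⊆ A * B → ∃ C, T ⊆ C ∧ C ⊆ A * B ∧ P (A.ncard + B.ncard) C := by
    intro T hT
    induction T, hT using Set.Finite.induction_on with
    | empty =>
      intro _
      obtain ⟨C, h1, _, h2⟩ := dyson_s5 _ A B rfl a0 ha0 b0 hb0
      exact ⟨C, Set.empty_subset _, h1, h2⟩
    | @insert t T _ _ ih =>
      intro hT
      obtain ⟨C, h1, h2, h3⟩ := ih ((Set.subset_insert _ _).trans hT)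
      obtain ⟨a, ha, b, hb, hab⟩ := hT (Set.mem_insert _ _)
      obtain ⟨C', h1', h2', h3'⟩ := dyson_s5 _ A B rfl a ha b hb
      refine ⟨C ∪ C', ?_, Set.union_subset h2 h1', h3.union h3'⟩
      apply Set.insert_subset
      · right; rw [← hab]; exact h2'
      · exact h1.trans Set.subset_union_left
  obtain ⟨C, h1, h2, h3⟩ := key _ (Set.toFinite _) subset_rfl
  rwa [h2.antisymm h1] at h3

lemma kneser_prod {ι : Type*} [Fintype ι] (S : ι → Set G) (hS : ∀ i, (S i).Nonempty) :
    ∃ H : Subgroup G, ∑ i, ((S i) * (H : Set G)).ncard + Nat.card H ≤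
      (∏ i, S i).ncard + Fintype.card ι * Nat.card H := by
  classical
  set T := ∏ i, S i with hT
  set H := MulAction.stabilizer G T with hH
  have hHT : (H : Set G) * T = T := by
    ext x
    constructor
    · rintro ⟨h, hh, t, ht, rfl⟩
      have hh' : h • T = T := hh
      rw [← hh']
      exact Set.smul_mem_smul_set ht
    · intro hx
      exact ⟨1, H.one_mem, x, hx, one_mul _⟩
  have hHH : (H : Set G) * (H : Set G) = H := by simp
  have key : ∀ s : Finset ι, ∑ i ∈ s, ((S i) * (H : Set G)).ncard + Nat.card H ≤
      ((H : Set G) * ∏ i ∈ s, S i).ncard + s.card * Nat.card H := by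
    intro s
    induction s using Finset.induction_on with
    | empty => simp; rfl
    | @insert i s hi ih =>
      rw [Finset.sum_insert hi, Finset.card_insert_of_notMem hi]
      have e : (H : Set G) * ∏ j ∈ insert i s, S j =
          ((H : Set G) * ∏ j ∈ s, S j) * (S i * (H : Set G)) := by
        rw [Finset.prod_insert hi, mul_comm (S i) (H : Set G), mul_mul_mul_comm, hHH, mul_comm (S i)]
      have ne : (∏ j ∈ s, S j).Nonempty := by
        choose f hf using hS
        exact ⟨∏ j ∈ s, f j, Set.finsetProd_mem_finsetProd _ _ _ fun j _ => hf j⟩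
      have neH : (H : Set G).Nonempty := ⟨1, H.one_mem⟩
      obtain ⟨K, hK, hc⟩ := kneser_s5 (neH.mul ne) ((hS i).mul neH)
      rw [← e] at hK hc
      have hKH : Nat.card K ≤ Nat.card H := by
        apply Subgroup.card_le_of_le
        intro k hk
        change k • T = T
        apply Set.eq_of_subset_of_ncard_le _ _ (Set.toFinite _)
        · have e2 : T = ((H : Set G) * ∏ j ∈ insert i s, S j) *
              ∏ j ∈ Finset.univ \ insert i s, S j := by
            rw [mul_assoc, mul_comm (∏ j ∈ insert i s, S j), Finset.prod_sdiff (Finset.subset_univ _), hHT]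
          rintro _ ⟨t, ht, rfl⟩
          rw [e2] at ht ⊢
          obtain ⟨u, hu, v, hv, rfl⟩ := ht
          exact ⟨k * u, hK k hk u hu, v, hv, mul_assoc _ _ _⟩
        · rw [Set.ncard_smul_set]
      rw [add_mul, one_mul]
      omega
  refine ⟨H, ?_⟩
  have := key Finset.univ
  rwa [hHT] at this

lemma card_dvd (H : Subgroup G) (S : Set G) : Nat.card H ∣ (S * (H : Set G)).ncard := by
  rw [← QuotientGroup.preimage_image_mk_eq_mul]
  rw [← Nat.card_coe_set_eq, Nat.card_congr (QuotientGroup.preimageMkEquivSubgroupProdSet H _), Nat.card_prod]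
  exact dvd_mul_right _ _

lemma le_card (H : Subgroup G) (S : Set G) :
    (Nat.card H : ℤ) * ⌈((S.ncard : ℚ)) / (Nat.card H : ℚ)⌉ ≤ (S * (H : Set G)).ncard := by
  obtain ⟨c, hc⟩ := card_dvd H S
  have hle : S.ncard ≤ (S * (H : Set G)).ncard := by
    apply Set.ncard_le_ncard _ (Set.toFinite _)
    intro x hx
    exact ⟨x, hx, 1, H.one_mem, mul_one _⟩
  have hp : 0 < Nat.card H := Nat.card_pos
  rw [hc] at hle ⊢
  push_cast
  apply mul_le_mul_of_nonneg_left _ (by positivity)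
  rw [Int.ceil_le, div_le_iff₀ (by exact_mod_cast hp)]
  rw [mul_comm]
  exact_mod_cast hle

end KN

open Finset in
lemma bwd (F : Type) [Field F] [Fintype F]
    (ω : ℕ) (hω : 3 ≤ ω) (d : Fin ω → ℕ) (hd : ∀ i, 2 ≤ d i) (e m : ℕ) (he : 0 < e)
    (hn : Nat.card Fˣ = e * m) (hm : ∑ i, ((d i - 1) / e) + 1 < m) : Realizable F ω d := by
  classical
  obtain ⟨g, hg⟩ := IsCyclic.exists_generator (α := Fˣ)
  have hord : orderOf g = e * m := by rw [orderOf_eq_card_of_forall_mem_zpowers hg, hn]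
  set f : ℕ → Fˣ := fun x => g ^ (x / e + m * (x % e)) with hf
  have hlt : ∀ x, x / e < m → x / e + m * (x % e) < e * m := by
    intro x hx
    have : x % e + 1 ≤ e := Nat.mod_lt _ he
    calc x / e + m * (x % e) < m + m * (x % e) := by omega
      _ = m * (x % e + 1) := by ring
      _ ≤ m * e := Nat.mul_le_mul_left _ this
      _ = e * m := mul_comm _ _
  have hinj : ∀ x y, x / e < m → y / e < m → f x = f y → x = y := by
    intro x y hx hy hxy
    have h1 := pow_injOn_Iio_orderOf (x := g) (by simpa [hord] using hlt x hx)
      (by simpa [hord] using hlt y hy) hxy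
    have h2 : x / e = y / e := by
      have := congrArg (· % m) h1
      simpa [Nat.add_mul_mod_self_left, Nat.mod_eq_of_lt hx, Nat.mod_eq_of_lt hy] using this
    have h3 : x % e = y % e := by
      simp only [h2] at h1
      exact Nat.eq_of_mul_eq_mul_left (by omega : 0 < m) (by omega)
    rw [← Nat.div_add_mod x e, ← Nat.div_add_mod y e, h2, h3]
  have hsm : ∀ i x, x < d i → x / e ≤ (d i - 1) / e := fun i x hx =>
    Nat.div_le_div_right (by omega)
  have hsm2 : ∀ i, (d i - 1) / e < m := fun i => by
    have := Finset.single_le_sum (f := fun i => (d i - 1) / e) (fun _ _ => Nat.zero_le _)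
      (Finset.mem_univ i)
    omega
  let i0 : Fin ω := ⟨0, by omega⟩
  let c : Fˣ := (-1) ^ (ω - 1) * (g ^ (m - 1))⁻¹
  let t : Fin ω → Fˣ := fun i => if i = i0 then c else 1
  have ht : ∏ i, t i = c := by simp [t]
  refine ⟨fun i => (range (d i)).image (fun x => ((t i * f x : Fˣ) : F)), ?_, ?_, ?_⟩
  · intro i h
    obtain ⟨x, _, hx⟩ := Finset.mem_image.1 h
    exact (t i * f x).ne_zero hx
  · intro i
    rw [Finset.card_image_of_injOn, card_range]
    intro x hx y hy hxy
    simp only [coe_range, Set.mem_Iio] at hx hy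
    apply hinj x y ((hsm i x hx).trans_lt (hsm2 i)) ((hsm i y hy).trans_lt (hsm2 i))
    exact mul_left_cancel (Units.ext hxy)
  · intro a ha heq
    have ha' : ∀ i, ∃ x < d i, ((t i * f x : Fˣ) : F) = a i := by
      intro i
      obtain ⟨x, hx, h⟩ := Finset.mem_image.1 (ha i)
      exact ⟨x, Finset.mem_range.1 hx, h⟩
    choose x hx hxa using ha'
    have e1 : ((-1 : Fˣ)) ^ (ω - 1) = ∏ i, (t i * f (x i)) := by
      apply Units.ext
      push_cast
      rw [heq]
      exact Finset.prod_congr rfl fun i _ => by rw [← hxa i]; push_cast; rfl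
    rw [Finset.prod_mul_distrib, ht] at e1
    have e2 : g ^ (m - 1) = ∏ i, f (x i) := by
      simp only [c] at e1
      rw [mul_assoc, left_eq_mul, inv_mul_eq_one] at e1
      exact e1
    simp only [hf] at e2
    rw [Finset.prod_pow_eq_pow_sum, pow_eq_pow_iff_modEq, hord, Finset.sum_add_distrib,
      ← Finset.mul_sum] at e2
    have e3 := Nat.ModEq.of_mul_left _ e2
    have hs : ∑ i, x i / e ≤ ∑ i, (d i - 1) / e := Finset.sum_le_sum fun i _ => hsm i _ (hx i)
    unfold Nat.ModEq at e3
    rw [Nat.add_mul_mod_self_left, Nat.mod_eq_of_lt (by omega), Nat.mod_eq_of_lt (by omega)] at e3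
    omega

lemma ceil_eq (d e : ℕ) (hd : 1 ≤ d) (he : 0 < e) :
    ⌈(d : ℚ) / (e : ℚ)⌉ = (((d - 1) / e : ℕ) : ℤ) + 1 := by
  have hq : (0 : ℚ) < e := by exact_mod_cast he
  have h1 := Nat.div_add_mod (d - 1) e
  have h2 := Nat.mod_lt (d - 1) he
  set k := (d - 1) / e
  set r := (d - 1) % e
  have h3 : d = e * k + r + 1 := by omega
  rw [Int.ceil_eq_iff]
  constructor
  · rw [lt_div_iff₀ hq]
    push_cast
    have : (d : ℚ) = e * k + r + 1 := by exact_mod_cast h3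
    rw [this]
    have : (0 : ℚ) ≤ r := by positivity
    nlinarith
  · rw [div_le_iff₀ hq]
    have : d ≤ (k + 1) * e := by rw [h3]; ring_nf; omega
    exact_mod_cast this

lemma fwd (F : Type) [Field F] [Fintype F]
    (ω : ℕ) (d : Fin ω → ℕ) (hd : ∀ i, 2 ≤ d i) (h : Realizable F ω d) :
    ∃ e, e ∣ Nat.card Fˣ ∧
      (e : ℤ) * (∑ i, ⌈((d i : ℚ)) / (e : ℚ)⌉ - (ω : ℤ) + 1) + 1 ≤ Nat.card Fˣ := by
  obtain ⟨S, h0, hc, hS⟩ := h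
  set S' : Fin ω → Set Fˣ := fun i => {u | (u : F) ∈ S i} with hS'
  have hc' : ∀ i, (S' i).ncard = d i := by
    intro i
    rw [← Set.ncard_image_of_injective (f := fun u : Fˣ => (u : F)) _ Units.val_injective, ← hc i,
      ← Set.ncard_coe_finset]
    congr 1
    ext x
    constructor
    · rintro ⟨u, hu, rfl⟩; exact hu
    · intro hx
      have : x ≠ 0 := fun h => h0 i (h ▸ hx)
      exact ⟨Units.mk0 x this, hx, rfl⟩
  have hne : ∀ i, (S' i).Nonempty := fun i => by
    apply Set.nonempty_of_ncard_ne_zero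
    have := hd i
    rw [hc' i]; omega
  obtain ⟨H, hH⟩ := KN.kneser_prod S' hne
  refine ⟨Nat.card H, Subgroup.card_subgroup_dvd_card H, ?_⟩
  have hlt : (∏ i, S' i).ncard < Nat.card Fˣ := by
    rw [← Set.ncard_univ]
    apply Set.ncard_lt_ncard _ (Set.toFinite _)
    rw [Set.ssubset_univ_iff]
    intro hu
    have : ((-1) ^ (ω - 1) : Fˣ) ∈ ∏ i, S' i := by rw [hu]; trivial
    rw [Set.mem_fintype_prod] at this
    obtain ⟨a, ha, hp⟩ := this
    apply hS (fun i => a i) ha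
    have := congrArg (fun u : Fˣ => (u : F)) hp
    simp only [Units.coe_prod] at this
    rw [this]; push_cast; rfl
  have hsum : (Nat.card H : ℤ) * ∑ i, ⌈((d i : ℚ)) / (Nat.card H : ℚ)⌉ ≤
      ∑ i, ((S' i * (H : Set Fˣ)).ncard : ℤ) := by
    rw [Finset.mul_sum]
    apply Finset.sum_le_sum
    intro i _
    have := KN.le_card H (S' i)
    rwa [hc' i] at this
  rw [Fintype.card_fin] at hH
  zify at hH hlt
  linarith

theorem realizable_iff_exists_divisor
    (F : Type) [Field F] [Fintype F] (q : ℕ) (hq : Fintype.card F = q)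
    (ω : ℕ) (hω : 3 ≤ ω) (d : Fin ω → ℕ) (hd : ∀ i, 2 ≤ d i) :
    Realizable F ω d ↔
      ∃ e ∈ (q - 1).divisors,
        (q : ℤ) ≥ (e : ℤ) * (∑ i, ⌈((d i : ℚ)) / (e : ℚ)⌉ - (ω : ℤ) + 1) + 2 := by
  have hcard : Nat.card Fˣ = q - 1 := by
    classical
    rw [Nat.card_eq_fintype_card, Fintype.card_units, hq]
  have hq1 : 1 < q := hq ▸ Fintype.one_lt_card
  constructor
  · intro h
    obtain ⟨e, h1, h2⟩ := fwd F ω d hd h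
    rw [hcard] at h1 h2
    refine ⟨e, Nat.mem_divisors.2 ⟨h1, by omega⟩, ?_⟩
    push_cast [hq1.le] at h2
    linarith
  · rintro ⟨e, he, h⟩
    obtain ⟨⟨m, hm⟩, _⟩ := Nat.mem_divisors.1 he
    have he0 : 0 < e := Nat.pos_of_mem_divisors he
    refine bwd F ω hω d hd e m he0 (by rw [hcard, hm]) ?_
    have hs : ∑ i, ⌈((d i : ℚ)) / (e : ℚ)⌉ = ((∑ i, (d i - 1) / e : ℕ) : ℤ) + ω := by
      rw [Finset.sum_congr rfl fun i _ => ceil_eq (d i) e (by have := hd i; omega) he0,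
        Finset.sum_add_distrib]
      simp
    rw [hs] at h
    have hqz : (q : ℤ) = e * m + 1 := by
      have : q = e * m + 1 := by omega
      exact_mod_cast this
    rw [hqz] at h
    have h' : (e : ℤ) * (((∑ i, (d i - 1) / e : ℕ) : ℤ) + 1) < e * m := by linarith
    have := lt_of_mul_lt_mul_left h' (by positivity)
    exact_mod_cast this
end

section
/- Let F and F' be finite fields of orders q and q', and let G be a subgroup of the multiplicative group F \ {0} with 1 < |G| < q − 1 such that for every subgroup G' of F' \ {0} with |G'| < q' − 1, either |G| > |G'| or q − |G| > q' − |G'|. Write d = |G|, and let ω ≥ 3 be an integer such that for every positive divisor d' of q' − 1 with d' < d, ω ≥ ((q'−1)/d' − ⌈(q−d−1)/d'⌉)/(⌈d/d'⌉ − 1) + 1 (as real numbers). Then for EVERY finite field F'' of order q'' < q, the ω-tuple (d, d, …, d, q−d−1) (with d repeated ω−1 times) is NOT realizable over F''; consequently q is the minimum field size over which this tuple is realizable. -/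
theorem subgroup_order_criterion_q_min
    (F F' : Type) [Field F] [Fintype F] [Field F'] [Fintype F']
    (q q' : ℕ) (hF : Fintype.card F = q) (hF' : Fintype.card F' = q')
    (G : Subgroup Fˣ) (d : ℕ) (hd : d = Nat.card G)
    (hd1 : 1 < d) (hd2 : d < q - 1)
    (hcrit : ∀ G' : Subgroup F'ˣ, Nat.card G' < q' - 1 →
      Nat.card G' < d ∨ (q' : ℤ) - (Nat.card G' : ℤ) < (q : ℤ) - (d : ℤ))
    (ω : ℕ) (hω : 3 ≤ ω)
    (hωbound : ∀ d' : ℕ, 0 < d' → d' ∣ q' - 1 → d' < d →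
      (ω : ℝ) ≥ (((q' : ℝ) - 1) / (d' : ℝ) - (⌈((q : ℝ) - (d : ℝ) - 1) / (d' : ℝ)⌉ : ℝ))
          / ((⌈(d : ℝ) / (d' : ℝ)⌉ : ℝ) - 1) + 1) :
    (∀ (F'' : Type) [Field F''] [Fintype F''], Fintype.card F'' < q →
      ¬ Realizable F'' ω (fun i => if (i : ℕ) = ω - 1 then q - d - 1 else d)) ∧
    Realizable F ω (fun i => if (i : ℕ) = ω - 1 then q - d - 1 else d) := by
  classical
  obtain ⟨n, rfl⟩ : ∃ n, ω = n + 2 := ⟨ω - 2, by omega⟩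
  constructor
  · rintro F'' _ _ hq ⟨S, h0, hc, hS⟩
    have hlast : (S (Fin.last (n+1))).card = q - d - 1 := by
      rw [hc]; simp
    have hzero : (S 0).card = d := by
      rw [hc]; simp
    have hne : ∀ i, ∃ x, x ∈ S i := by
      intro i
      have : (S i).Nonempty := by
        rw [← Finset.card_pos, hc]
        dsimp only
        split_ifs <;> omega
      exact this
    choose b hb using hne
    have hb0 : ∀ i, b i ≠ 0 := fun i h => h0 i (h ▸ hb i)
    set P : F'' := ∏ i : Fin n, b i.castSucc.succ with hP
    have hP0 : P ≠ 0 := Finset.prod_ne_zero_iff.2 fun i _ => hb0 _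
    set t : F'' := (-1) ^ (n + 2 - 1) with ht
    have ht0 : t ≠ 0 := pow_ne_zero _ (by simp)
    have key : ∀ x ∈ S 0, ∀ y ∈ S (Fin.last (n+1)), t ≠ x * (P * y) := by
      intro x hx y hy
      have := hS (Function.update (Function.update b 0 x) (Fin.last (n+1)) y) (by
        intro i
        by_cases h1 : i = Fin.last (n+1)
        · subst h1; simpa using hy
        · rw [Function.update_of_ne h1]
          by_cases h2 : i = 0
          · subst h2; simpa using hx
          · rw [Function.update_of_ne h2]; exact hb i)
      rw [Fin.prod_univ_succ, Fin.prod_univ_castSucc] at this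
      have e1 : (0 : Fin (n+2)) ≠ Fin.last (n+1) := by simp [Fin.ext_iff]
      have e2 : ∀ i : Fin n, i.castSucc.succ ≠ Fin.last (n+1) := by
        intro i; have := i.2; simp only [ne_eq, Fin.ext_iff, Fin.val_succ, Fin.val_castSucc, Fin.val_last]; omega
      rw [Function.update_of_ne e1, Function.update_self, Fin.succ_last, Function.update_self] at this
      have e3 : ∏ i : Fin n, Function.update (Function.update b 0 x) (Fin.last (n+1)) y i.castSucc.succ = P := by
        refine Finset.prod_congr rfl fun i _ => ?_
        rw [Function.update_of_ne (e2 i), Function.update_of_ne (Fin.succ_ne_zero _)]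
      rw [e3] at this
      exact this
    have hx0 : ∀ x ∈ S 0, x ≠ 0 := fun x hx h => h0 0 (h ▸ hx)
    have hinj : Set.InjOn (fun x => t / (x * P)) (S 0) := by
      intro x hx y hy hxy
      have := hx0 x hx
      have := hx0 y hy
      dsimp only at hxy
      field_simp at hxy
      exact hxy.symm
    have hdisj : Disjoint ((S 0).image (fun x => t / (x * P))) (S (Fin.last (n+1))) := by
      rw [Finset.disjoint_left]
      intro z hz hz'
      obtain ⟨x, hx, rfl⟩ := Finset.mem_image.1 hz
      apply key x hx _ hz'
      have := hx0 x hx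
      field_simp
    have hsub : ((S 0).image (fun x => t / (x * P))) ∪ (S (Fin.last (n+1))) ⊆ Finset.univ.erase 0 := by
      intro z hz
      refine Finset.mem_erase.2 ⟨?_, Finset.mem_univ _⟩
      rintro rfl
      rcases Finset.mem_union.1 hz with h | h
      · obtain ⟨x, hx, hx'⟩ := Finset.mem_image.1 h
        exact div_ne_zero ht0 (mul_ne_zero (hx0 x hx) hP0) hx'
      · exact h0 _ h
    have hcard := Finset.card_le_card hsub
    rw [Finset.card_union_of_disjoint hdisj, Finset.card_image_of_injOn hinj, hlast, hzero,
      Finset.card_erase_of_mem (Finset.mem_univ _), Finset.card_univ] at hcard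
    omega
  · set t : Fˣ := (-1) ^ (n + 2 - 1) with ht
    let A : Finset Fˣ := Finset.univ.filter (fun x => x ∈ G)
    let B : Finset Fˣ := Finset.univ.filter (fun x => t * x⁻¹ ∉ G)
    have hA : A.card = d := by
      rw [hd, Nat.card_eq_fintype_card, Fintype.card_subtype]
    have hAB : (Finset.univ.filter (fun x => t * x⁻¹ ∈ G)).card = d := by
      rw [← hA]
      refine Finset.card_bij' (fun x _ => t * x⁻¹) (fun x _ => x⁻¹ * t) ?_ ?_ ?_ ?_
      · intro x hx; simpa [A] using hx
      · intro x hx; simpa [A] using hx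
      · intro x hx; simp
      · intro x hx; simp
    have hB : B.card = q - d - 1 := by
      have h1 := Finset.card_filter_add_card_filter_not (s := (Finset.univ : Finset Fˣ)) (fun x => t * x⁻¹ ∈ G)
      rw [hAB, Finset.card_univ, Fintype.card_units, hF] at h1
      change d + B.card = _ at h1
      omega
    have hinj : Function.Injective (fun x : Fˣ => (x : F)) := fun x y h => Units.ext h
    refine ⟨fun i => (if (i : ℕ) = n + 2 - 1 then B else A).image (fun x : Fˣ => (x : F)), ?_, ?_, ?_⟩
    · intro i h
      obtain ⟨x, _, hx⟩ := Finset.mem_image.1 h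
      exact x.ne_zero hx
    · intro i
      rw [Finset.card_image_of_injective _ hinj]
      dsimp only
      split_ifs <;> assumption
    · intro a ha heq
      have ha' : ∀ i : Fin (n+2), ∃ x : Fˣ, x ∈ (if (i : ℕ) = n + 2 - 1 then B else A) ∧ (x : F) = a i :=
        fun i => Finset.mem_image.1 (ha i)
      choose u hu hua using ha'
      have h1 : t = ∏ i, u i := by
        apply Units.ext
        rw [Units.coe_prod]
        simp only [hua, ← heq, ht]
        simp
      rw [Fin.prod_univ_castSucc] at h1
      have hl : u (Fin.last (n+1)) ∈ B := by
        have := hu (Fin.last (n+1)); simpa using this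
      have h2 : t * (u (Fin.last (n+1)))⁻¹ ∉ G := (Finset.mem_filter.1 hl).2
      apply h2
      rw [h1, mul_inv_cancel_right]
      refine Subgroup.prod_mem _ fun i _ => ?_
      have h3 := hu i.castSucc
      rw [if_neg (by have := i.2; simp only [Fin.val_castSucc]; omega)] at h3
      exact (Finset.mem_filter.1 h3).2
end

section
/- Let n_1 and n_2 be two coprime integers larger than 1, and let c_1, c_2, δ be real numbers with c_1 > c_2. Then there are infinitely many pairs of positive integers (k, k') such that log_{n_1}(n_2^{k'}) + c_1 > k > log_{n_1}(n_2^{k'} + δ) + c_2; that is, for every positive integer N there exist positive integers k, k' with k' ≥ N satisfying these inequalities. -/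
open Filter Topology in
theorem irr_logb_aux (n₁ n₂ : ℕ) (h₁ : 1 < n₁) (h₂ : 1 < n₂) (hcop : Nat.Coprime n₁ n₂) :
    Irrational (Real.logb n₁ n₂) := by
  have h1 : (1 : ℝ) < n₁ := by exact_mod_cast h₁
  have h2 : (1 : ℝ) < n₂ := by exact_mod_cast h₂
  rintro ⟨r, hr⟩
  have hpos : 0 < Real.logb n₁ n₂ := Real.logb_pos h1 h2
  have hrpos : 0 < r := by rw [← hr] at hpos; exact_mod_cast hpos
  obtain ⟨p, hp⟩ := Int.eq_ofNat_of_zero_le (Rat.num_pos.2 hrpos).le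
  have hq : (r.den : ℝ) ≠ 0 := by exact_mod_cast r.den_ne_zero
  have hrr : (r : ℝ) * r.den = p := by
    have := Rat.mul_den_eq_num r
    rw [hp] at this
    exact_mod_cast this
  have hlog1 : Real.log n₁ ≠ 0 := (Real.log_pos h1).ne'
  have key : (n₂ : ℝ) ^ r.den = (n₁ : ℝ) ^ p := by
    apply Real.log_injOn_pos (Set.mem_Ioi.2 (by positivity)) (Set.mem_Ioi.2 (by positivity))
    rw [Real.log_pow, Real.log_pow, ← hrr, hr, Real.logb]
    field_simp
  have key' : n₂ ^ r.den = n₁ ^ p := by exact_mod_cast key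
  have hc : Nat.Coprime (n₁ ^ p) (n₂ ^ r.den) := hcop.pow _ _
  rw [← key', Nat.coprime_self] at hc
  have := Nat.one_lt_pow r.den_ne_zero h₂
  omega

open Filter Topology in
theorem freq_round_aux (a : ℝ) (ha : Irrational a) (m ε : ℝ) (hε : 0 < ε) :
    ∃ᶠ n : ℕ in atTop, ∃ k : ℤ, |n * a + m - k| < ε := by
  have hd : DenseRange (· • (a : AddCircle (1 : ℝ)) : ℤ → AddCircle (1 : ℝ)) :=
    AddCircle.denseRange_zsmul_coe_iff.2 (by simpa using ha)
  have hm : MapClusterPt ((-m : ℝ) : AddCircle (1 : ℝ)) atTop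
      (· • (a : AddCircle (1 : ℝ)) : ℕ → AddCircle (1 : ℝ)) :=
    ((mapClusterPt_atTop_nsmul_tfae _ _).out 0 2).2 ((denseRange_zsmul_iff_nsmul.1 hd) _)
  have := hm.frequently (Metric.ball_mem_nhds _ hε)
  refine this.mono fun n hn => ⟨round (n * a + m), ?_⟩
  rw [dist_eq_norm, ← AddCircle.coe_nsmul, ← AddCircle.coe_sub, UnitAddCircle.norm_eq] at hn
  simpa using hn

open Filter Topology in
theorem diophantine_approximation_logb
    (n₁ n₂ : ℕ) (h₁ : 1 < n₁) (h₂ : 1 < n₂) (hcop : Nat.Coprime n₁ n₂)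
    (c₁ c₂ δ : ℝ) (hc : c₁ > c₂) :
    ∀ N : ℕ, 0 < N → ∃ k k' : ℕ, 0 < k ∧ N ≤ k' ∧
      Real.logb (n₁ : ℝ) ((n₂ : ℝ) ^ k') + c₁ > (k : ℝ) ∧
      (k : ℝ) > Real.logb (n₁ : ℝ) ((n₂ : ℝ) ^ k' + δ) + c₂ := by
  intro N _
  have h1 : (1 : ℝ) < n₁ := by exact_mod_cast h₁
  have h2 : (1 : ℝ) < n₂ := by exact_mod_cast h₂
  have hpos : 0 < Real.logb n₁ n₂ := Real.logb_pos h1 h2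
  have hirr := irr_logb_aux n₁ n₂ h₁ h₂ hcop
  set a := Real.logb n₁ n₂ with ha
  have hε : 0 < (c₁ - c₂) / 4 := by linarith
  have hf := freq_round_aux a hirr ((c₁ + c₂) / 2) _ hε
  have hpow : Tendsto (fun n : ℕ => (n₂ : ℝ) ^ n) atTop atTop :=
    tendsto_pow_atTop_atTop_of_one_lt h2
  have e1 : ∀ᶠ n : ℕ in atTop, (c₁ - c₂) / 4 - (c₁ + c₂) / 2 < n * a :=
    (tendsto_natCast_atTop_atTop.atTop_mul_const hpos).eventually_gt_atTop _
  have hlim : Tendsto (fun n : ℕ => Real.logb n₁ (1 + δ / (n₂ : ℝ) ^ n)) atTop (𝓝 0) := by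
    have h0 : Tendsto (fun n : ℕ => 1 + δ / (n₂ : ℝ) ^ n) atTop (𝓝 1) := by
      simpa using (hpow.const_div_atTop δ).const_add 1
    have := (h0.log one_ne_zero).div_const (Real.log n₁)
    simpa [Real.logb] using this
  have e2 := hlim.eventually_lt_const hε
  have e3 := hpow.eventually_gt_atTop (-δ)
  obtain ⟨n, ⟨k, hk⟩, g1, g2, g3, g4⟩ :=
    (hf.and_eventually (e1.and (e2.and (e3.and (eventually_ge_atTop N))))).exists
  rw [abs_lt] at hk
  have hkpos : (0 : ℝ) < k := by linarith
  have hkpos' : 0 < k := by exact_mod_cast hkpos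
  lift k to ℕ using hkpos'.le
  have hP : 0 < (n₂ : ℝ) ^ n := by positivity
  have hl : Real.logb n₁ ((n₂ : ℝ) ^ n) = n * a := by rw [Real.logb_pow]
  have hs : Real.logb n₁ ((n₂ : ℝ) ^ n + δ)
      = n * a + Real.logb n₁ (1 + δ / (n₂ : ℝ) ^ n) := by
    have e : (n₂ : ℝ) ^ n + δ = (n₂ : ℝ) ^ n * (1 + δ / (n₂ : ℝ) ^ n) := by field_simp
    have hne : 1 + δ / (n₂ : ℝ) ^ n ≠ 0 := by
      intro h
      rw [h] at e
      linarith
    rw [e, Real.logb_mul hP.ne' hne, hl]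
  push_cast at hk
  refine ⟨k, n, by exact_mod_cast hkpos', g4, ?_, ?_⟩
  · rw [hl]; linarith
  · rw [hs]; linarith
end

section
/- Let k ≥ 2 be an integer and set q = 2^{2k} and d = (2^{2k} − 1)/3. Then 3 divides 2^{2k} − 1, and for every divisor d' of 2^{2k+1} − 1 with d' < 2^{2k+1} − 1, one has d > d'. Consequently, the pair of finite fields (GF(2^{2k}), GF(2^{2k+1})) satisfies the subgroup order criterion with witness the subgroup G of order d in GF(2^{2k}) \ {0}. -/
theorem subgroup_order_criterion_char_two (k : ℕ) (hk : 2 ≤ k) :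
    3 ∣ 2 ^ (2 * k) - 1 ∧
    (∀ d' : ℕ, d' ∣ 2 ^ (2 * k + 1) - 1 → d' < 2 ^ (2 * k + 1) - 1 →
      d' < (2 ^ (2 * k) - 1) / 3) ∧
    (∀ (F F' : Type) [Field F] [Fintype F] [Field F'] [Fintype F'],
      Fintype.card F = 2 ^ (2 * k) → Fintype.card F' = 2 ^ (2 * k + 1) →
      ∃ G : Subgroup Fˣ, Nat.card G = (2 ^ (2 * k) - 1) / 3 ∧
        1 < Nat.card G ∧ Nat.card G < 2 ^ (2 * k) - 1 ∧
        ∀ G' : Subgroup F'ˣ, Nat.card G' < 2 ^ (2 * k + 1) - 1 →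
          Nat.card G' < Nat.card G ∨
          ((2 : ℤ) ^ (2 * k + 1) - (Nat.card G' : ℤ) <
            (2 : ℤ) ^ (2 * k) - (Nat.card G : ℤ))) := by
  have hN : (2 ^ (2 * k)) % 15 = 1 ∨ (2 ^ (2 * k)) % 15 = 4 := by
    clear hk
    induction k with
    | zero => left; norm_num
    | succ n ih =>
      have : 2 ^ (2 * (n + 1)) = 4 * 2 ^ (2 * n) := by ring
      omega
  have hN16 : 16 ≤ 2 ^ (2 * k) := by
    calc 16 = 2 ^ 4 := by norm_num
      _ ≤ 2 ^ (2 * k) := Nat.pow_le_pow_right (by norm_num) (by omega)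
  have hS : 2 ^ (2 * k + 1) = 2 * 2 ^ (2 * k) := by ring
  have h3 : 3 ∣ 2 ^ (2 * k) - 1 := by omega
  have hd : ∀ d' : ℕ, d' ∣ 2 ^ (2 * k + 1) - 1 → d' < 2 ^ (2 * k + 1) - 1 →
      d' < (2 ^ (2 * k) - 1) / 3 := by
    rintro d' ⟨c, hc⟩ hlt
    rw [hS] at hc hlt
    generalize 2 ^ (2 * k) = N at *
    have hc7 : 7 ≤ c := by
      by_contra! h
      interval_cases c <;> omega
    have := Nat.mul_le_mul_left d' hc7
    omega
  refine ⟨h3, hd, ?_⟩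
  intro F F' _ _ _ _ hF hF'
  have cF : Nat.card Fˣ = 2 ^ (2 * k) - 1 := by
    rw [Nat.card_units, Nat.card_eq_fintype_card, hF]
  have cF' : Nat.card F'ˣ = 2 ^ (2 * k + 1) - 1 := by
    rw [Nat.card_units, Nat.card_eq_fintype_card, hF']
  obtain ⟨g, hg⟩ := IsCyclic.exists_generator (α := Fˣ)
  have hG : Nat.card (Subgroup.zpowers (g ^ 3)) = (2 ^ (2 * k) - 1) / 3 := by
    rw [Nat.card_zpowers, orderOf_pow, orderOf_eq_card_of_forall_mem_zpowers hg, cF,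
      Nat.gcd_eq_right h3]
  refine ⟨Subgroup.zpowers (g ^ 3), hG, ?_, ?_, ?_⟩
  · rw [hG]; omega
  · rw [hG]; omega
  · intro G' hG'
    left
    rw [hG]
    exact hd _ (cF' ▸ Subgroup.card_subgroup_dvd_card G') hG'
end
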